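/- arXiv:2212.10119 — 7 statements merged into one kernel-verified Lean document; each statement's English description precedes it below -/
import Mathlib

section
/- Let X be a metric space, R ⊆ X a subset, and u : X → [−∞, ∞) a function. For a subset A ⊆ X and a point x ∈ X write u^{*A}(x) := limsup_{A∋y→x} u(y), the limit superior of u along the trace on A of the neighborhood filter of x (with the convention that this equals −∞ when x is not in the closure of A). If u(x) = u^{*R}(x) for every x ∈ X ∖ R, then u^{*X}(x) = u^{*R}(x) for every x ∈ X. -/
open Filter Topology

/-- Let `X` be a metric space, `R ⊆ X`, and `u : X → [-∞, ∞)`.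
Writing `u^{*A}(x) = limsup_{A ∋ y → x} u y` (the limsup of `u` along the trace on `A` of
the neighborhood filter of `x`, which is `-∞` when `x ∉ closure A`), if `u = u^{*R}` on
`X \ R`, then `u^{*X} = u^{*R}` on all of `X`. -/
theorem statement0 {X : Type*} [MetricSpace X] (R : Set X) (u : X → EReal)
    (hu : ∀ x, u x ≠ ⊤)
    (h : ∀ x ∉ R, u x = Filter.limsup u (nhdsWithin x R)) :
    ∀ x : X, Filter.limsup u (nhdsWithin x Set.univ) = Filter.limsup u (nhdsWithin x R) := by
  intro x
  apply le_antisymm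
  · refine le_of_forall_gt_imp_ge_of_dense fun c hc => ?_
    have h1 : ∀ᶠ y in nhdsWithin x R, u y < c := eventually_lt_of_limsup_lt hc
    have h2 : ∀ᶠ y in 𝓝 x, y ∈ R → u y < c := eventually_nhdsWithin_iff.mp h1
    rw [nhdsWithin_univ]
    refine limsup_le_of_le (by isBoundedDefault) ?_
    filter_upwards [h2.eventually_nhds] with y hy
    by_cases hyR : y ∈ R
    · exact (hy.self_of_nhds hyR).le
    · rw [h y hyR]
      refine limsup_le_of_le (by isBoundedDefault) ?_
      exact (eventually_nhdsWithin_iff.mpr hy).mono fun z hz => hz.le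
  · exact limsup_le_limsup_of_le (nhdsWithin_mono x (Set.subset_univ R))
end

section
/- Let V ⊆ ℂ^N be a closed unbounded set and let f : V → ℂ^M be continuous and proper (preimages of compact sets are compact). Then ρ(f⁻¹, f(V)) ≥ 1/ρ(f,V), where ρ(f,V) ∈ [0,+∞] and the conventions 1/(+∞) := 0 and 1/0 := +∞ are used. -/
open Filter MvPolynomial Metric Set ENNReal

/-- extended logarithm of a nonnegative real number, with `elog 0 = -∞`. -/
noncomputable def elog (t : ℝ) : EReal := if t = 0 then ⊥ else ((Real.log t : ℝ) : EReal)

/-- the filter of points of `V` whose norm tends to infinity. -/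
def atInftyOn {E : Type*} [Norm E] (V : Set E) : Filter E :=
  (Filter.comap (fun z => ‖z‖) Filter.atTop) ⊓ Filter.principal V

/-- the quotient `log ‖f z‖ / log ‖z‖`, computed in the extended reals. -/
noncomputable def logRatio {E F : Type*} [Norm E] [Norm F] (f : E → F) (z : E) : EReal :=
  elog ‖f z‖ / elog ‖z‖

/-- the growth exponent `ρ(f, V)` of `f` on `V`. -/
noncomputable def growthExp {E F : Type*} [Norm E] [Norm F] (f : E → F) (V : Set E) : EReal :=
  Filter.limsup (logRatio f) (atInftyOn V)

/-- `log ‖f⁻¹(w)‖ = log sup {‖z‖ : z ∈ V, f z = w}`, computed in the extended reals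
(`-∞` for an empty fiber). -/
noncomputable def fiberLogNorm {E F : Type*} [Norm E] [Norm F] (f : E → F) (V : Set E)
    (w : F) : EReal :=
  sSup ((fun z => elog ‖z‖) '' {z | z ∈ V ∧ f z = w})

/-- the order `ρ(f⁻¹, f(V))` of `f` on `V`: the growth exponent of the multifunction `f⁻¹`
on `f(V)`. -/
noncomputable def orderExp {E F : Type*} [Norm E] [Norm F] (f : E → F) (V : Set E) : EReal :=
  Filter.limsup (fun w => fiberLogNorm f V w / elog ‖w‖) (atInftyOn (f '' V))

/-- the Łojasiewicz exponent at infinity `L∞(f|V)`, with `sup ∅ = -∞`. -/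
noncomputable def lojExp {E F : Type*} [Norm E] [Norm F] (f : E → F) (V : Set E) : EReal :=
  sSup {x : EReal | ∃ d : ℝ, x = (d : EReal) ∧
    ∃ C : ℝ, 0 < C ∧ ∃ R : ℝ, 0 < R ∧ ∀ z ∈ V, R < ‖z‖ → C * ‖z‖ ^ d < ‖f z‖}

/-- inverse on `[0,+∞] ⊆ EReal` with the conventions `1/∞ = 0` and `1/0 = ∞`. -/
noncomputable def invE (x : EReal) : EReal :=
  if x = ⊤ then 0 else if x = 0 then ⊤ else (((x.toReal)⁻¹ : ℝ) : EReal)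

/-- evaluation of a polynomial of `n` variables at a point of `ℂⁿ`. -/
noncomputable def evalAt {n : ℕ} (z : EuclideanSpace ℂ (Fin n))
    (p : MvPolynomial (Fin n) ℂ) : ℂ :=
  MvPolynomial.eval (fun i => z i) p

/-- an algebraic subset of `ℂⁿ`: the common zero set of finitely many polynomials. -/
def IsAlgebraicSet {n : ℕ} (A : Set (EuclideanSpace ℂ (Fin n))) : Prop :=
  ∃ S : Finset (MvPolynomial (Fin n) ℂ), A = {z | ∀ p ∈ S, evalAt z p = 0}

/-- the ideal of all polynomials vanishing identically on `A`. -/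
noncomputable def vanishIdeal {n : ℕ} (A : Set (EuclideanSpace ℂ (Fin n))) :
    Ideal (MvPolynomial (Fin n) ℂ) :=
  RingHom.ker (Pi.ringHom fun z : A =>
    MvPolynomial.eval (fun i => (z : EuclideanSpace ℂ (Fin n)) i))

/-- a polynomial mapping on `A`: the restriction to `A` of a mapping all of whose
components are polynomials. -/
def IsPolyMapOn {N M : ℕ} (f : EuclideanSpace ℂ (Fin N) → EuclideanSpace ℂ (Fin M))
    (A : Set (EuclideanSpace ℂ (Fin N))) : Prop :=
  ∃ P : Fin M → MvPolynomial (Fin N) ℂ, ∀ z ∈ A, ∀ j, f z j = evalAt z (P j)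

/-- a holomorphic mapping on `A`: locally the restriction of a holomorphic mapping on an
open subset of the ambient space. -/
def IsHoloOn {N M : ℕ} (f : EuclideanSpace ℂ (Fin N) → EuclideanSpace ℂ (Fin M))
    (A : Set (EuclideanSpace ℂ (Fin N))) : Prop :=
  ∀ z ∈ A, ∃ U : Set (EuclideanSpace ℂ (Fin N)), IsOpen U ∧ z ∈ U ∧
    ∃ F : EuclideanSpace ℂ (Fin N) → EuclideanSpace ℂ (Fin M),
      DifferentiableOn ℂ F U ∧ Set.EqOn f F (U ∩ A)

/-- the pluricomplex Green function of a compact set `K ⊆ ℂⁿ`, in its Siciak–Zaharjuta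
polynomial form `V_K(z) = sup { (deg q)⁻¹ · log⁺ |q(z)| }`. -/
noncomputable def greenV {n : ℕ} (K : Set (EuclideanSpace ℂ (Fin n)))
    (z : EuclideanSpace ℂ (Fin n)) : EReal :=
  sSup {x : EReal | ∃ q : MvPolynomial (Fin n) ℂ, 1 ≤ q.totalDegree ∧
    (∀ w ∈ K, ‖evalAt w q‖ ≤ 1) ∧
    x = (((q.totalDegree : ℝ)⁻¹ * max (Real.log ‖evalAt z q‖) 0 : ℝ) : EReal)}

/-- For a closed unbounded `V ⊆ ℂᴺ` and a continuous proper map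
`f : V → ℂᴹ`, the order of `f` satisfies `ρ(f⁻¹, f(V)) ≥ 1/ρ(f,V)`, with the conventions
`1/∞ = 0` and `1/0 = ∞`. -/
theorem statement4 {N M : ℕ} (V : Set (EuclideanSpace ℂ (Fin N)))
    (f : EuclideanSpace ℂ (Fin N) → EuclideanSpace ℂ (Fin M))
    (hVclosed : IsClosed V) (hVunb : ¬ Bornology.IsBounded V)
    (hf : ContinuousOn f V)
    (hproper : ∀ K : Set (EuclideanSpace ℂ (Fin M)), IsCompact K → IsCompact (V ∩ f ⁻¹' K)) :
    invE (growthExp f V) ≤ orderExp f V := by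
  by_contra hlt
  rw [not_le] at hlt
  obtain ⟨b, hb1, hb2⟩ := EReal.lt_iff_exists_real_btwn.1 hlt
  have hev : ∀ᶠ w in atInftyOn (f '' V), fiberLogNorm f V w / elog ‖w‖ < (b : EReal) :=
    Filter.eventually_lt_of_limsup_lt hb1
  have hne : (atInftyOn V).NeBot := by
    unfold atInftyOn
    rw [comap_norm_atTop, ← Filter.frequently_mem_iff_neBot]
    intro h
    apply hVunb
    rw [← Bornology.isCobounded_compl_iff]
    exact h
  have htend : Tendsto f (atInftyOn V) (atInftyOn (f '' V)) := by
    unfold atInftyOn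
    rw [tendsto_inf]
    constructor
    · rw [comap_norm_atTop, comap_norm_atTop]
      intro s hs
      obtain ⟨R, hR⟩ := (Metric.isBounded_iff_subset_closedBall (0 : EuclideanSpace ℂ (Fin M))).1
        (Bornology.isBounded_def.2 (by rwa [compl_compl] : sᶜᶜ ∈ Bornology.cobounded _))
      have hc := (hproper _ (isCompact_closedBall (0 : EuclideanSpace ℂ (Fin M)) R)).isBounded
      rw [Filter.mem_map, Filter.mem_inf_principal]
      filter_upwards [Bornology.isBounded_def.1 hc] with z hz hzV
      by_contra hzs
      exact hz ⟨hzV, hR hzs⟩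
    · rw [tendsto_principal]
      have : ∀ᶠ z in (Filter.comap (fun z : EuclideanSpace ℂ (Fin N) => ‖z‖) atTop) ⊓ 𝓟 V, z ∈ V :=
        Filter.mem_inf_of_right (Filter.mem_principal_self V)
      exact this.mono fun z hz => Set.mem_image_of_mem f hz
  have hV : ∀ᶠ z in atInftyOn V, z ∈ V := Filter.mem_inf_of_right (Filter.mem_principal_self V)
  have hbig : ∀ᶠ z in atInftyOn V, 1 < ‖z‖ :=
    Filter.mem_inf_of_left (tendsto_comap.eventually (eventually_gt_atTop 1))
  have hbig' : ∀ᶠ z in atInftyOn V, 1 < ‖f z‖ := by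
    refine htend.eventually (p := fun w => 1 < ‖w‖) ?_
    exact Filter.mem_inf_of_left (tendsto_comap.eventually (eventually_gt_atTop 1))
  have key : ∀ᶠ z in atInftyOn V, 0 < b ∧ ((b⁻¹ : ℝ) : EReal) ≤ logRatio f z := by
    filter_upwards [hV, hbig, hbig', htend.eventually hev] with z hzV h1 h2 h3
    have l1 := Real.log_pos h1
    have l2 := Real.log_pos h2
    have e1 : elog ‖z‖ = ((Real.log ‖z‖ : ℝ) : EReal) := if_neg (by linarith)
    have e2 : elog ‖f z‖ = ((Real.log ‖f z‖ : ℝ) : EReal) := if_neg (by linarith)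
    have hle : elog ‖z‖ ≤ fiberLogNorm f V (f z) := le_sSup ⟨z, ⟨hzV, rfl⟩, rfl⟩
    have h4 : elog ‖z‖ / elog ‖f z‖ < (b : EReal) := by
      refine lt_of_le_of_lt (EReal.div_le_div_right_of_nonneg ?_ hle) h3
      rw [e2]; exact_mod_cast l2.le
    unfold logRatio
    rw [e1, e2, ← EReal.coe_div, EReal.coe_lt_coe_iff] at h4
    have hb : 0 < b := lt_trans (div_pos l1 l2) h4
    refine ⟨hb, ?_⟩
    rw [e1, e2, ← EReal.coe_div, EReal.coe_le_coe_iff]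
    rw [div_lt_iff₀ l2] at h4
    rw [le_div_iff₀ l1, inv_mul_le_iff₀ hb]
    exact h4.le
  obtain ⟨_, hb, _⟩ := key.exists
  have hρ : ((b⁻¹ : ℝ) : EReal) ≤ growthExp f V :=
    Filter.le_limsup_of_frequently_le (key.mono fun z h => h.2).frequently
  have hbi : 0 < b⁻¹ := inv_pos.2 hb
  revert hb2 hρ
  generalize growthExp f V = ρ
  intro hb2 hρ
  induction ρ with
  | bot => simp at hρ
  | top =>
    simp only [invE, if_true] at hb2
    have : b < 0 := by exact_mod_cast hb2
    linarith
  | coe r =>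
    rw [EReal.coe_le_coe_iff] at hρ
    have hr : 0 < r := lt_of_lt_of_le hbi hρ
    have h0 : (r : EReal) ≠ 0 := by exact_mod_cast hr.ne'
    rw [invE, if_neg (EReal.coe_ne_top r), if_neg h0, EReal.coe_lt_coe_iff, EReal.toReal_coe] at hb2
    have := inv_anti₀ hbi hρ
    rw [inv_inv] at this
    linarith
end

section
/- Let V ⊆ ℂ^N be a closed unbounded set and let f : V → ℂ^M be a continuous map such that ‖f(z)‖ → ∞ as ‖z‖ → ∞ along z ∈ V (in particular, this holds if f is proper). Assume 0 < L∞(f|V) < ∞. Then ρ(f⁻¹, f(V)) ≥ 1/L∞(f|V). -/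
open Filter MvPolynomial Metric Set ENNReal

/-- Let `V ⊆ ℂᴺ` be closed and unbounded and `f : V → ℂᴹ` continuous with
`‖f z‖ → ∞` as `‖z‖ → ∞` along `V` (in particular this holds if `f` is proper). If
`0 < L∞(f|V) < ∞`, then `ρ(f⁻¹, f(V)) ≥ 1/L∞(f|V)`. -/
theorem statement7 {N M : ℕ} (V : Set (EuclideanSpace ℂ (Fin N)))
    (f : EuclideanSpace ℂ (Fin N) → EuclideanSpace ℂ (Fin M))
    (hVclosed : IsClosed V) (hVunb : ¬ Bornology.IsBounded V)
    (hf : ContinuousOn f V)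
    (htend : Filter.Tendsto (fun z => ‖f z‖) (atInftyOn V) Filter.atTop)
    (hloj0 : 0 < lojExp f V) (hlojt : lojExp f V < ⊤) :
    ((((lojExp f V).toReal)⁻¹ : ℝ) : EReal) ≤ orderExp f V := by
  by_contra hcon
  rw [not_le] at hcon
  obtain ⟨L, hL⟩ : ∃ L : ℝ, lojExp f V = (L : EReal) :=
    ⟨(lojExp f V).toReal,
      (EReal.coe_toReal hlojt.ne (ne_bot_of_gt hloj0)).symm⟩
  have hL0 : 0 < L := by
    rw [hL] at hloj0
    exact_mod_cast hloj0
  rw [hL, EReal.toReal_coe] at hcon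
  obtain ⟨c0, hc1, hc2⟩ := EReal.lt_iff_exists_real_btwn.1 hcon
  have hc2' : c0 < L⁻¹ := by exact_mod_cast hc2
  have hLi : 0 < L⁻¹ := inv_pos.2 hL0
  obtain ⟨c, hc0, hcL, hcc⟩ : ∃ c : ℝ, 0 < c ∧ c < L⁻¹ ∧ c0 ≤ c :=
    ⟨max c0 (L⁻¹ / 2), lt_max_of_lt_right (by linarith), max_lt hc2' (by linarith),
      le_max_left _ _⟩
  have hlt : orderExp f V < (c : EReal) := lt_of_lt_of_le hc1 (by exact_mod_cast hcc)
  have hev := Filter.eventually_lt_of_limsup_lt hlt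
  have hmap : Filter.Tendsto f (atInftyOn V) (atInftyOn (f '' V)) := by
    refine Filter.tendsto_inf.2 ⟨Filter.tendsto_comap_iff.2 htend, ?_⟩
    refine Filter.tendsto_principal.2 ?_
    have : ∀ᶠ z in atInftyOn V, z ∈ V :=
      Filter.mem_inf_of_right (Filter.mem_principal_self V)
    exact this.mono fun z hz => ⟨z, hz, rfl⟩
  have hev2 := (hmap.eventually hev).and (htend.eventually (Filter.eventually_gt_atTop 1))
  have hev3 : ∃ R : ℝ, ∀ z ∈ V, R ≤ ‖z‖ →
      fiberLogNorm f V (f z) / elog ‖f z‖ < (c : EReal) ∧ 1 < ‖f z‖ := by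
    have h := Filter.eventually_inf_principal.1 hev2
    obtain ⟨R, hR⟩ := Filter.eventually_atTop.1 (Filter.eventually_comap.1 h)
    exact ⟨R, fun z hz hzR => hR ‖z‖ hzR z rfl hz⟩
  obtain ⟨R, hR⟩ := hev3
  have hmem : ((c⁻¹ : ℝ) : EReal) ≤ lojExp f V := by
    refine le_sSup ⟨c⁻¹, rfl, 1, one_pos, max R 1, lt_max_of_lt_right one_pos, ?_⟩
    intro z hz hzR
    obtain ⟨h1, h2⟩ := hR z hz ((le_max_left _ _).trans hzR.le)
    have hz1 : 1 < ‖z‖ := (le_max_right _ _).trans_lt hzR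
    have hz0 : 0 < ‖z‖ := one_pos.trans hz1
    have hf0 : 0 < ‖f z‖ := one_pos.trans h2
    have hlog : 0 < Real.log ‖f z‖ := Real.log_pos h2
    have h3 : elog ‖z‖ ≤ fiberLogNorm f V (f z) := le_sSup ⟨z, ⟨hz, rfl⟩, rfl⟩
    have e1 : elog ‖f z‖ = ((Real.log ‖f z‖ : ℝ) : EReal) := if_neg hf0.ne'
    have e2 : elog ‖z‖ = ((Real.log ‖z‖ : ℝ) : EReal) := if_neg hz0.ne'
    rw [e1, EReal.div_lt_iff (by exact_mod_cast hlog) (EReal.coe_ne_top _)] at h1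
    rw [e2] at h3
    have h4 : Real.log ‖z‖ < c * Real.log ‖f z‖ := by exact_mod_cast h3.trans_lt h1
    rw [one_mul, ← Real.log_lt_log_iff (Real.rpow_pos_of_pos hz0 _) hf0, Real.log_rpow hz0,
      inv_mul_lt_iff₀ hc0]
    exact h4
  rw [hL] at hmem
  have h5 : c⁻¹ ≤ L := by exact_mod_cast hmem
  exact absurd (inv_le_of_inv_le₀ hc0 h5) (not_le.2 hcL)
end

section
/- Let V ⊆ ℂ^N be an unbounded set and let f : V → ℂ^M be a map with unbounded image such that ‖z‖ → ∞ whenever ‖f(z)‖ → ∞ along z ∈ V (equivalently, f is bounded on bounded subsets of V; this holds in particular when f is the restriction to V of a polynomial mapping ℂ^N → ℂ^M). Assume 0 < L∞(f|V) < ∞. Then ρ(f⁻¹, f(V)) ≤ 1/L∞(f|V). -/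
open Filter MvPolynomial Metric Set ENNReal

/-- Let `V ⊆ ℂᴺ` be unbounded and `f : V → ℂᴹ` a map with unbounded image
such that `‖z‖ → ∞` whenever `‖f z‖ → ∞` along `z ∈ V`. If `0 < L∞(f|V) < ∞`, then
`ρ(f⁻¹, f(V)) ≤ 1/L∞(f|V)`. -/
theorem statement8 {N M : ℕ} (V : Set (EuclideanSpace ℂ (Fin N)))
    (f : EuclideanSpace ℂ (Fin N) → EuclideanSpace ℂ (Fin M))
    (hVunb : ¬ Bornology.IsBounded V) (hfVunb : ¬ Bornology.IsBounded (f '' V))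
    (htend : Filter.Tendsto (fun z => ‖z‖)
      ((Filter.comap (fun z => ‖f z‖) Filter.atTop) ⊓ Filter.principal V) Filter.atTop)
    (hloj0 : 0 < lojExp f V) (hlojt : lojExp f V < ⊤) :
    orderExp f V ≤ ((((lojExp f V).toReal)⁻¹ : ℝ) : EReal) := by
  obtain ⟨l, hl⟩ : ∃ l : ℝ, lojExp f V = (l : EReal) := by
    refine ⟨(lojExp f V).toReal, (EReal.coe_toReal hlojt.ne ?_).symm⟩
    exact (lt_trans EReal.bot_lt_zero hloj0).ne'
  rw [hl] at hloj0
  have hl0 : 0 < l := by exact_mod_cast hloj0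
  rw [hl, EReal.toReal_coe]
  rw [← EReal.le_of_forall_lt_iff_le]
  intro c hc
  have hc' : l⁻¹ < c := by exact_mod_cast hc
  have hc0 : 0 < c := lt_trans (inv_pos.mpr hl0) hc'
  have hcl : ((c⁻¹ : ℝ) : EReal) < lojExp f V := by
    rw [hl]
    exact_mod_cast inv_lt_of_inv_lt₀ hl0 hc'
  obtain ⟨_, ⟨d, rfl, C, hC, R, hR, hz⟩, hd⟩ := lt_sSup_iff.mp hcl
  have hd' : c⁻¹ < d := by exact_mod_cast hd
  have hd0 : 0 < d := lt_trans (inv_pos.mpr hc0) hd'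
  have hdc : 0 < d * c - 1 := by
    have := (inv_lt_iff_one_lt_mul₀ hc0).mp hd'
    linarith
  unfold orderExp
  refine Filter.limsup_le_of_le (by isBoundedDefault) ?_
  have hT : Tendsto (fun w : EuclideanSpace ℂ (Fin M) => Real.log ‖w‖)
      (atInftyOn (f '' V)) atTop :=
    Real.tendsto_log_atTop.comp (tendsto_comap.mono_left inf_le_left)
  filter_upwards [hT.eventually_gt_atTop 0,
    hT.eventually_ge_atTop (-Real.log C / (d * c - 1)),
    hT.eventually_ge_atTop (Real.log R / c)] with w h0 h1 h2
  have hw : ‖w‖ ≠ 0 := by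
    intro h
    rw [h] at h0
    simp at h0
  have he : elog ‖w‖ = ((Real.log ‖w‖ : ℝ) : EReal) := by simp only [elog, if_neg hw]
  rw [he]
  rw [EReal.div_le_iff_le_mul (by exact_mod_cast h0) (EReal.coe_ne_top _)]
  unfold fiberLogNorm
  apply sSup_le
  rintro _ ⟨z, ⟨hzV, rfl⟩, rfl⟩
  simp only [elog]
  split_ifs with hz0
  · exact bot_le
  have hzp : 0 < ‖z‖ := lt_of_le_of_ne (norm_nonneg _) (Ne.symm hz0)
  rw [div_le_iff₀ hdc] at h1
  rw [div_le_iff₀ hc0] at h2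
  norm_cast
  rcases le_or_gt ‖z‖ R with hzR | hzR
  · have := Real.log_le_log hzp hzR
    linarith
  · have h3 := Real.log_lt_log (by positivity) (hz z hzV hzR)
    rw [Real.log_mul hC.ne' (by positivity), Real.log_rpow hzp] at h3
    have h4 : d * Real.log ‖z‖ ≤ d * (Real.log ‖f z‖ * c) := by nlinarith
    exact le_of_mul_le_mul_left h4 hd0
end

section
/- Let 𝒜 ⊆ ℂ^N (N ≥ 2) be an irreducible algebraic set of positive dimension (equivalently, an irreducible algebraic set which is infinite), and let f : 𝒜 → ℂ^M be a proper polynomial mapping on 𝒜. Then L∞(f|𝒜) = 1/ρ(f⁻¹, f(𝒜)), with the conventions 1/(+∞) := 0 and 1/0 := +∞. -/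
open Filter MvPolynomial Metric Set ENNReal

theorem eventually_atInftyOn {E : Type*} [Norm E] {V : Set E} {P : E → Prop} :
    (∀ᶠ w in atInftyOn V, P w) ↔ ∃ r : ℝ, ∀ w ∈ V, r ≤ ‖w‖ → P w := by
  unfold atInftyOn
  rw [Filter.eventually_inf_principal, Filter.eventually_comap, Filter.eventually_atTop]
  constructor
  · rintro ⟨r, hr⟩
    exact ⟨r, fun w hw h => hr _ h w rfl hw⟩
  · rintro ⟨r, hr⟩
    exact ⟨r, fun b hb w hw hV => hr w hV (by rw [hw]; exact hb)⟩

theorem evalAt_bound {n : ℕ} (p : MvPolynomial (Fin n) ℂ) :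
    ∃ C : ℝ, 0 ≤ C ∧ ∃ D : ℕ, ∀ z : EuclideanSpace ℂ (Fin n),
      ‖evalAt z p‖ ≤ C * (1 + ‖z‖) ^ D := by
  induction p using MvPolynomial.induction_on with
  | C a => exact ⟨‖a‖, norm_nonneg _, 0, fun z => by simp [evalAt]⟩
  | add p q hp hq =>
    obtain ⟨C, hC, D, h⟩ := hp
    obtain ⟨C', hC', D', h'⟩ := hq
    refine ⟨C + C', by positivity, max D D', fun z => ?_⟩
    have h1 : (1:ℝ) ≤ 1 + ‖z‖ := by linarith [norm_nonneg z]
    calc ‖evalAt z (p + q)‖ ≤ ‖evalAt z p‖ + ‖evalAt z q‖ := by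
          simp only [evalAt, map_add]; exact norm_add_le _ _
      _ ≤ C * (1 + ‖z‖) ^ D + C' * (1 + ‖z‖) ^ D' := add_le_add (h z) (h' z)
      _ ≤ C * (1 + ‖z‖) ^ (max D D') + C' * (1 + ‖z‖) ^ (max D D') := by
          gcongr
          · exact le_max_left _ _
          · exact le_max_right _ _
      _ = _ := by ring
  | mul_X p i hp =>
    obtain ⟨C, hC, D, h⟩ := hp
    refine ⟨C, hC, D + 1, fun z => ?_⟩
    have h2 : ‖z i‖ ≤ 1 + ‖z‖ := by linarith [PiLp.norm_apply_le z i]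
    calc ‖evalAt z (p * X i)‖ = ‖evalAt z p‖ * ‖z i‖ := by simp [evalAt]
      _ ≤ (C * (1 + ‖z‖) ^ D) * (1 + ‖z‖) := by
          gcongr
          exact h z
      _ = _ := by ring

theorem map_bound {N M : ℕ} {f : EuclideanSpace ℂ (Fin N) → EuclideanSpace ℂ (Fin M)}
    {A : Set (EuclideanSpace ℂ (Fin N))} (hpoly : IsPolyMapOn f A) :
    ∃ C : ℝ, 0 ≤ C ∧ ∃ D : ℕ, ∀ z ∈ A, ‖f z‖ ≤ C * (1 + ‖z‖) ^ D := by
  obtain ⟨P, hP⟩ := hpoly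
  choose C hC D hD using fun j => evalAt_bound (P j)
  refine ⟨∑ j, C j, Finset.sum_nonneg fun j _ => hC j, ∑ j, D j, fun z hz => ?_⟩
  have h1 : (1:ℝ) ≤ 1 + ‖z‖ := by linarith [norm_nonneg z]
  have h2 : ‖f z‖ ≤ ∑ j, ‖f z j‖ := by
    rw [EuclideanSpace.norm_eq]
    apply Real.sqrt_le_iff.2
    exact ⟨Finset.sum_nonneg fun j _ => norm_nonneg _,
      Finset.sum_sq_le_sq_sum_of_nonneg (fun j _ => norm_nonneg _)⟩
  refine h2.trans ?_
  rw [Finset.sum_mul]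
  refine Finset.sum_le_sum fun j _ => ?_
  rw [hP z hz j]
  refine (hD j z).trans ?_
  have := hC j
  gcongr
  exact Finset.single_le_sum (f := D) (fun i _ => Nat.zero_le _) (Finset.mem_univ j)

theorem unbounded_of_infinite {N : ℕ} (A : Set (EuclideanSpace ℂ (Fin N)))
    (halg : IsAlgebraicSet A) (hprime : (vanishIdeal A).IsPrime) (hinf : A.Infinite) :
    ∀ R : ℝ, ∃ z ∈ A, R < ‖z‖ := by
  have hmem : ∀ p, p ∈ vanishIdeal A ↔ ∀ z ∈ A, evalAt z p = 0 := by
    intro p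
    constructor
    · intro h z hz
      exact congrFun (RingHom.mem_ker.1 h) ⟨z, hz⟩
    · intro h
      exact RingHom.mem_ker.2 (funext fun z => h z.1 z.2)
  obtain ⟨S, hS⟩ := halg
  obtain ⟨s, -, g, ginj, gint⟩ :=
    exists_integral_inj_algHom_of_quotient (vanishIdeal A) hprime.ne_top
  have gint' : RingHom.IsIntegral (R := MvPolynomial (Fin s) ℂ)
      (A := MvPolynomial (Fin N) ℂ ⧸ vanishIdeal A) g.toRingHom := gint
  rcases Nat.eq_zero_or_pos s with rfl | hs
  · exfalso
    have hI : (algebraMap ℂ (MvPolynomial (Fin N) ℂ ⧸ vanishIdeal A)).IsIntegral := by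
      have h1 : (algebraMap ℂ (MvPolynomial (Fin 0) ℂ)).IsIntegral := by
        apply RingHom.isIntegral_of_surjective
        intro p
        exact ⟨_, (MvPolynomial.eq_C_of_isEmpty p).symm⟩
      have h2 := RingHom.IsIntegral.trans _ _ h1 gint'
      have h3 : g.toRingHom.comp (algebraMap ℂ (MvPolynomial (Fin 0) ℂ)) = algebraMap ℂ _ :=
        AlgHom.comp_algebraMap g
      rw [h3] at h2
      exact h2
    have hsurj := (IsAlgClosed.ringHom_bijective_of_isIntegral _ hI).2
    choose c hc using fun i : Fin N => hsurj (Ideal.Quotient.mk _ (X i))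
    apply hinf
    have hsub : A.Subsingleton := by
      have key : ∀ z ∈ A, ∀ i, z i = c i := by
        intro z hz i
        have h := hc i
        have h2 : (C (c i) - X i : MvPolynomial (Fin N) ℂ) ∈ vanishIdeal A :=
          Ideal.Quotient.eq.1 h
        have h3 := (hmem _).1 h2 z hz
        simp only [evalAt, map_sub, eval_C, eval_X] at h3
        exact (sub_eq_zero.1 h3).symm
      intro z hz w hw
      ext i
      rw [key z hz i, key w hw i]
    exact hsub.finite
  · intro R
    by_contra hcon
    push Not at hcon
    obtain ⟨p, hp⟩ := Ideal.Quotient.mk_surjective (g (X ⟨0, hs⟩))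
    obtain ⟨K, hK, D, hKD⟩ := evalAt_bound p
    -- every value is attained
    have hval : ∀ c : ℂ, ∃ z ∈ A, evalAt z p = c := by
      intro c
      have hne : Ideal.span {(X ⟨0, hs⟩ - C c : MvPolynomial (Fin s) ℂ)} ≠ ⊤ := by
        rw [Ne, Ideal.span_singleton_eq_top]
        intro hu
        have := hu.map (MvPolynomial.eval (fun _ => c))
        simp at this
      have hne2 := (Ideal.map_eq_top_iff g.toRingHom ginj gint').not.2 hne
      obtain ⟨m, hm, hle⟩ := Ideal.exists_le_maximal _ hne2
      have hmax : (m.comap (Ideal.Quotient.mk (vanishIdeal A))).IsMaximal :=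
        Ideal.comap_isMaximal_of_surjective _ Ideal.Quotient.mk_surjective
      obtain ⟨x, hx⟩ := eq_vanishingIdeal_singleton_of_isMaximal ℂ hmax
      have hx' : ∀ q, Ideal.Quotient.mk (vanishIdeal A) q ∈ m → eval x q = 0 := by
        intro q hq
        have : q ∈ m.comap (Ideal.Quotient.mk (vanishIdeal A)) := hq
        rw [hx, mem_vanishingIdeal_singleton_iff] at this
        simpa [aeval_eq_eval] using this
      refine ⟨WithLp.toLp 2 x, ?_, ?_⟩
      · rw [hS]
        intro q hq
        apply hx'
        have : q ∈ vanishIdeal A := by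
          rw [hmem]
          intro z hz
          rw [hS] at hz
          exact hz q hq
        rw [Ideal.Quotient.eq_zero_iff_mem.2 this]
        exact m.zero_mem
      · have h1 : Ideal.Quotient.mk (vanishIdeal A) (p - C c) ∈ m := by
          have h2 : g.toRingHom (X ⟨0, hs⟩ - C c) ∈ m :=
            hle (Ideal.mem_map_of_mem _ (Ideal.subset_span rfl))
          have h3 : g (C c) = Ideal.Quotient.mk (vanishIdeal A) (C c) :=
            AlgHom.commutes g c
          rw [map_sub, hp, ← h3, ← map_sub]
          exact h2
        have h4 := hx' _ h1
        rw [map_sub, eval_C] at h4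
        exact sub_eq_zero.1 h4
    obtain ⟨z, hz, hzv⟩ := hval ((K * (1 + |R|) ^ D + 1 : ℝ) : ℂ)
    have h1 := hKD z
    rw [hzv, Complex.norm_real, Real.norm_eq_abs] at h1
    have h2 : ‖z‖ ≤ |R| := (hcon z hz).trans (le_abs_self R)
    have h3 : K * (1 + ‖z‖) ^ D ≤ K * (1 + |R|) ^ D := by gcongr
    have := le_abs_self (K * (1 + |R|) ^ D + 1)
    linarith

theorem proper_tendsto {N M : ℕ} {f : EuclideanSpace ℂ (Fin N) → EuclideanSpace ℂ (Fin M)}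
    {A : Set (EuclideanSpace ℂ (Fin N))}
    (hproper : ∀ K : Set (EuclideanSpace ℂ (Fin M)), IsCompact K → IsCompact (A ∩ f ⁻¹' K)) :
    ∀ r : ℝ, ∃ R : ℝ, 1 ≤ R ∧ ∀ z ∈ A, R < ‖z‖ → r < ‖f z‖ := by
  intro r
  have h := hproper _ (isCompact_closedBall (0 : EuclideanSpace ℂ (Fin M)) r)
  obtain ⟨R, hR⟩ := h.isBounded.exists_norm_le
  refine ⟨max R 1, le_max_right _ _, fun z hz hzR => ?_⟩
  by_contra hc
  push Not at hc
  have := hR z ⟨hz, by simpa using hc⟩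
  exact absurd (lt_of_le_of_lt (le_max_left _ _) hzR) (not_lt.2 this)

/-- admissible exponents -/
def Feas {E F : Type*} [Norm E] [Norm F] (f : E → F) (V : Set E) (d : ℝ) : Prop :=
  ∃ C : ℝ, 0 < C ∧ ∃ R : ℝ, 0 < R ∧ ∀ z ∈ V, R < ‖z‖ → C * ‖z‖ ^ d < ‖f z‖

theorem order_le_of_feas {E F : Type*} [NormedAddCommGroup E] [NormedAddCommGroup F]
    {f : E → F} {V : Set E} {d e : ℝ} (hd : 0 < d) (hf : Feas f V d) (he : d⁻¹ < e) :
    orderExp f V ≤ (e : EReal) := by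
  obtain ⟨C, hC, R, hR, h⟩ := hf
  have he0 : 0 < e := (inv_pos.2 hd).trans he
  have hde : 0 < d * e - 1 := by
    have := mul_lt_mul_of_pos_left he hd
    rw [mul_inv_cancel₀ hd.ne'] at this
    linarith
  apply Filter.limsup_le_of_le
  · isBoundedDefault
  rw [eventually_atInftyOn]
  set B : ℝ := max 1 (max (Real.log R / e) (-Real.log C / (d * e - 1))) with hB
  refine ⟨Real.exp B, fun w hw hwn => ?_⟩
  have hwpos : 0 < ‖w‖ := (Real.exp_pos _).trans_le hwn
  have hlog : B ≤ Real.log ‖w‖ := (Real.le_log_iff_exp_le hwpos).2 hwn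
  have hl1 : 1 ≤ Real.log ‖w‖ := (le_max_left _ _).trans hlog
  have hl2 : Real.log R ≤ Real.log ‖w‖ * e :=
    (div_le_iff₀ he0).1 (((le_max_left _ _).trans (le_max_right _ _)).trans hlog)
  have hl3 : -Real.log C ≤ Real.log ‖w‖ * (d * e - 1) :=
    (div_le_iff₀ hde).1 (((le_max_right _ _).trans (le_max_right _ _)).trans hlog)
  have hel : elog ‖w‖ = ((Real.log ‖w‖ : ℝ) : EReal) := if_neg hwpos.ne'
  rw [hel, EReal.div_le_iff_le_mul (by exact_mod_cast (by linarith : (0:ℝ) < Real.log ‖w‖))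
    (EReal.coe_ne_top _), ← EReal.coe_mul]
  apply sSup_le
  rintro _ ⟨z, ⟨hz, rfl⟩, rfl⟩
  simp only [elog]
  split_ifs with h0
  · exact bot_le
  have hzpos : 0 < ‖z‖ := lt_of_le_of_ne (norm_nonneg _) (Ne.symm h0)
  rw [EReal.coe_le_coe_iff]
  by_cases hzR : R < ‖z‖
  · have h5 := Real.log_lt_log (by positivity) (h z hz hzR)
    rw [Real.log_mul hC.ne' (by positivity), Real.log_rpow hzpos] at h5
    by_contra hc
    push Not at hc
    have := mul_lt_mul_of_pos_left hc hd
    linarith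
  · push Not at hzR
    exact (Real.log_le_log hzpos hzR).trans hl2

theorem feas_of_order_lt {E F : Type*} [NormedAddCommGroup E] [NormedAddCommGroup F]
    {f : E → F} {V : Set E} (hp : ∀ r : ℝ, ∃ R : ℝ, 1 ≤ R ∧ ∀ z ∈ V, R < ‖z‖ → r < ‖f z‖)
    {e : ℝ} (he : 0 < e) (h : orderExp f V < (e : EReal)) : Feas f V e⁻¹ := by
  have h1 := Filter.eventually_lt_of_limsup_lt h
  rw [eventually_atInftyOn] at h1
  obtain ⟨r, hr⟩ := h1
  obtain ⟨R, hR1, hR⟩ := hp (max r 1)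
  refine ⟨1 / 2, by norm_num, R, by linarith, fun z hz hzR => ?_⟩
  have hw := hR z hz hzR
  have hw1 : 1 < ‖f z‖ := (le_max_right _ _).trans_lt hw
  have hzpos : 0 < ‖z‖ := by linarith
  have hl : 0 < Real.log ‖f z‖ := Real.log_pos hw1
  have h2 := (hr (f z) ⟨z, hz, rfl⟩ ((le_max_left _ _).trans hw.le)).le
  have hel : elog ‖f z‖ = ((Real.log ‖f z‖ : ℝ) : EReal) := if_neg (by positivity)
  rw [hel, EReal.div_le_iff_le_mul (by exact_mod_cast hl)
    (EReal.coe_ne_top _), ← EReal.coe_mul] at h2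
  have h3 : elog ‖z‖ ≤ fiberLogNorm f V (f z) := le_sSup ⟨z, ⟨hz, rfl⟩, rfl⟩
  have h4 := h3.trans h2
  have hel2 : elog ‖z‖ = ((Real.log ‖z‖ : ℝ) : EReal) := if_neg hzpos.ne'
  rw [hel2, EReal.coe_le_coe_iff] at h4
  have h5 : ‖z‖ ^ e⁻¹ ≤ ‖f z‖ := by
    rw [← Real.log_le_log_iff (by positivity) (by positivity), Real.log_rpow hzpos,
      inv_mul_le_iff₀ he]
    linarith
  have : 0 < ‖z‖ ^ e⁻¹ := by positivity
  linarith

theorem feas_le {E F : Type*} [NormedAddCommGroup E] [NormedAddCommGroup F]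
    {f : E → F} {V : Set E} {K : ℝ} (hK : 0 ≤ K) {D : ℕ}
    (hb : ∀ z ∈ V, ‖f z‖ ≤ K * (1 + ‖z‖) ^ D)
    (hu : ∀ R : ℝ, ∃ z ∈ V, R < ‖z‖) {d : ℝ} (hd : Feas f V d) : d ≤ D := by
  obtain ⟨C, hC, R, hR, h⟩ := hd
  by_contra hc
  push Not at hc
  have hdD : 0 < d - D := by linarith
  have ht := (tendsto_rpow_atTop hdD).eventually_ge_atTop (K * 2 ^ D / C)
  obtain ⟨T, hT⟩ := Filter.eventually_atTop.1 ht
  obtain ⟨z, hz, hzb⟩ := hu (max R (max T 1))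
  have hzR : R < ‖z‖ := (le_max_left _ _).trans_lt hzb
  have hzT : T < ‖z‖ := ((le_max_left _ _).trans (le_max_right _ _)).trans_lt hzb
  have hz1 : 1 < ‖z‖ := ((le_max_right _ _).trans (le_max_right _ _)).trans_lt hzb
  have h1 := (h z hz hzR).trans_le (hb z hz)
  have h2 := (div_le_iff₀ hC).1 (hT _ hzT.le)
  have hzpos : 0 < ‖z‖ := by linarith
  have h3 : K * (1 + ‖z‖) ^ D ≤ K * (2 ^ D * ‖z‖ ^ D) := by
    rw [← mul_pow]
    gcongr
    linarith
  have h4 : ‖z‖ ^ d = ‖z‖ ^ (d - D) * ‖z‖ ^ D := by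
    rw [← Real.rpow_natCast, ← Real.rpow_add hzpos]
    congr 1
    ring
  rw [h4] at h1
  have h5 : K * 2 ^ D * ‖z‖ ^ D ≤ ‖z‖ ^ (d - D) * C * ‖z‖ ^ D := by gcongr
  nlinarith

/-- Let `𝒜 ⊆ ℂᴺ` (`N ≥ 2`) be an irreducible algebraic set of positive
dimension (equivalently, infinite: its vanishing ideal is prime and the set is infinite),
and let `f : 𝒜 → ℂᴹ` be a proper polynomial mapping on `𝒜`. Then
`L∞(f|𝒜) = 1/ρ(f⁻¹, f(𝒜))`, with the conventions `1/∞ = 0` and `1/0 = ∞`. -/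
theorem statement9 {N M : ℕ} (hN : 2 ≤ N) (A : Set (EuclideanSpace ℂ (Fin N)))
    (f : EuclideanSpace ℂ (Fin N) → EuclideanSpace ℂ (Fin M))
    (halg : IsAlgebraicSet A) (hprime : (vanishIdeal A).IsPrime) (hinf : A.Infinite)
    (hpoly : IsPolyMapOn f A)
    (hproper : ∀ K : Set (EuclideanSpace ℂ (Fin M)), IsCompact K → IsCompact (A ∩ f ⁻¹' K)) :
    lojExp f A = invE (orderExp f A) := by
  obtain ⟨K, hK, D, hb⟩ := map_bound hpoly
  have hu := unbounded_of_infinite A halg hprime hinf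
  have hp := proper_tendsto hproper
  have hL : lojExp f A = sSup {x : EReal | ∃ d : ℝ, x = (d : EReal) ∧ Feas f A d} := rfl
  have hle : ∀ d, Feas f A d → (d : EReal) ≤ lojExp f A := by
    intro d hd
    rw [hL]
    exact le_sSup ⟨d, rfl, hd⟩
  have h0 : Feas f A 0 := by
    obtain ⟨R, hR1, hR⟩ := hp 1
    exact ⟨1, one_pos, R, by linarith, fun z hz hzR => by simpa using hR z hz hzR⟩
  have hpos : (((D : ℝ) + 1)⁻¹ : ℝ) ≤ orderExp f A := by
    by_contra hc
    push Not at hc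
    have h1 := feas_of_order_lt hp (by positivity) hc
    have h2 := feas_le hK hb hu h1
    rw [inv_inv] at h2
    linarith
  have hD : (0 : ℝ) < ((D : ℝ) + 1)⁻¹ := by positivity
  generalize hρ : orderExp f A = ρ at hpos
  induction ρ with
  | bot => exact absurd hpos (by simp)
  | top =>
    simp only [invE, if_true]
    apply le_antisymm
    · rw [hL]
      apply sSup_le
      rintro _ ⟨d, rfl, hd⟩
      by_contra hc
      have hd0 : 0 < d := by
        push Not at hc
        exact_mod_cast hc
      have := order_le_of_feas hd0 hd (lt_add_one _)
      rw [hρ] at this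
      exact absurd (top_le_iff.1 this) (EReal.coe_ne_top _)
    · exact_mod_cast hle 0 h0
  | coe r =>
    have hr : 0 < r := hD.trans_le (by exact_mod_cast hpos)
    have hinv : invE (r : EReal) = ((r⁻¹ : ℝ) : EReal) := by
      simp [invE, hr.ne']
    rw [hinv]
    apply le_antisymm
    · rw [hL]
      apply sSup_le
      rintro _ ⟨d, rfl, hd⟩
      rw [EReal.coe_le_coe_iff]
      rcases le_or_gt d 0 with hd0 | hd0
      · exact hd0.trans (by positivity)
      · rw [le_inv_comm₀ hd0 hr]
        apply le_of_forall_gt_imp_ge_of_dense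
        intro e he
        have := order_le_of_feas hd0 hd he
        rw [hρ] at this
        exact_mod_cast this
    · apply le_of_forall_lt_imp_le_of_dense
      intro a ha
      induction a with
      | bot => exact bot_le
      | top => exact absurd ha (by simp)
      | coe a =>
        rcases le_or_gt a 0 with ha0 | ha0
        · exact le_trans (by exact_mod_cast ha0) (hle 0 h0)
        · have ha' : a < r⁻¹ := by exact_mod_cast ha
          have h1 : r < a⁻¹ := (lt_inv_comm₀ ha0 hr).1 ha'
          have h2 := feas_of_order_lt (e := a⁻¹) hp (inv_pos.2 ha0)
            (by rw [hρ]; exact_mod_cast h1)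
          rw [inv_inv] at h2
          exact hle a h2
end

section
/- Let 𝒜 ⊆ ℂ^N be an irreducible algebraic set of positive dimension (equivalently, infinite) and let K ⊆ 𝒜 be a nonempty compact set. For z ∈ ℂ^N put Φ_K(z) := sup{|p(z)|^{1/deg p} : p ∈ ℂ[z₁,…,z_N], deg p ≥ 1, sup_K |p| ≤ 1} and Φ_{K,𝒜}(z) := sup{|p(z)|^{1/ρ(p,𝒜)} : p ∈ ℂ[z₁,…,z_N], sup_K |p| ≤ 1, 0 < ρ(p,𝒜) < ∞}, where ρ(p,𝒜) := limsup_{𝒜∋z→∞} log|p(z)|/log‖z‖ is the growth exponent of p on 𝒜. Then Φ_K(z) = Φ_{K,𝒜}(z) for every z ∈ 𝒜 (values taken in [0,+∞]). -/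
open Filter MvPolynomial Metric Set ENNReal

/-- the classical Siciak extremal function `Φ_K` of a compact set `K ⊆ ℂⁿ`. -/
noncomputable def siciakPhi {n : ℕ} (K : Set (EuclideanSpace ℂ (Fin n)))
    (z : EuclideanSpace ℂ (Fin n)) : ℝ≥0∞ :=
  sSup {x : ℝ≥0∞ | ∃ p : MvPolynomial (Fin n) ℂ, 1 ≤ p.totalDegree ∧
    (∀ w ∈ K, ‖evalAt w p‖ ≤ 1) ∧
    x = ENNReal.ofReal (‖evalAt z p‖ ^ ((p.totalDegree : ℝ)⁻¹))}

/-- the Siciak extremal function `Φ_{K,𝒜}` of `K` on an algebraic set `A`, defined via the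
growth exponent `ρ(p,A)` in place of the degree. -/
noncomputable def siciakPhiOn {n : ℕ} (A K : Set (EuclideanSpace ℂ (Fin n)))
    (z : EuclideanSpace ℂ (Fin n)) : ℝ≥0∞ :=
  sSup {x : ℝ≥0∞ | ∃ p : MvPolynomial (Fin n) ℂ,
    (∀ w ∈ K, ‖evalAt w p‖ ≤ 1) ∧
    0 < growthExp (fun y => evalAt y p) A ∧ growthExp (fun y => evalAt y p) A < ⊤ ∧
    x = ENNReal.ofReal (‖evalAt z p‖ ^ (((growthExp (fun y => evalAt y p) A).toReal)⁻¹))}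

lemma hom_scale {σ : Type*} {F : MvPolynomial σ ℂ} {d : ℕ} (hF : F.IsHomogeneous d) (t : ℂ)
    (u : σ → ℂ) : MvPolynomial.eval (fun i => t * u i) F = t ^ d * MvPolynomial.eval u F := by
  rw [MvPolynomial.eval_eq, MvPolynomial.eval_eq, Finset.mul_sum]
  refine Finset.sum_congr rfl fun m hm => ?_
  have := hF.degree_eq_sum_deg_support hm
  simp only [mul_pow, Finset.prod_mul_distrib, Finset.prod_pow_eq_pow_sum]
  rw [this]
  change _ = t ^ (∑ i ∈ m.support, m i) * _
  ring

/-- the homogenization of a polynomial. -/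
noncomputable def homz {σ : Type*} (F : MvPolynomial σ ℂ) (τ : ℂ) (u : σ → ℂ) : ℂ :=
  ∑ d ∈ Finset.range (F.totalDegree + 1),
    τ ^ (F.totalDegree - d) * MvPolynomial.eval u (MvPolynomial.homogeneousComponent d F)

lemma homz_eval {σ : Type*} (F : MvPolynomial σ ℂ) (t : ℂ) (ht : t ≠ 0) (u : σ → ℂ) :
    MvPolynomial.eval (fun i => t * u i) F = t ^ F.totalDegree * homz F t⁻¹ u := by
  conv_lhs => rw [← MvPolynomial.sum_homogeneousComponent F]
  rw [map_sum, homz, Finset.mul_sum]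
  refine Finset.sum_congr rfl fun d hd => ?_
  rw [hom_scale (MvPolynomial.homogeneousComponent_isHomogeneous d F)]
  have hd' : d ≤ F.totalDegree := by simpa [Nat.lt_succ_iff] using hd
  rw [← mul_assoc]
  congr 1
  rw [inv_pow, ← div_eq_mul_inv, eq_div_iff (pow_ne_zero _ ht), ← pow_add]
  congr 1; omega

lemma homz_zero {σ : Type*} (F : MvPolynomial σ ℂ) (u : σ → ℂ) :
    homz F 0 u = MvPolynomial.eval u (MvPolynomial.homogeneousComponent F.totalDegree F) := by
  rw [homz, Finset.sum_eq_single F.totalDegree]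
  · simp
  · intro d hd hne
    have hd' : d ≤ F.totalDegree := by simpa [Nat.lt_succ_iff] using hd
    rw [zero_pow (by omega), zero_mul]
  · simp

lemma homz_cont {σ : Type*} (F : MvPolynomial σ ℂ) :
    Continuous (fun x : ℂ × (σ → ℂ) => homz F x.1 x.2) := by
  unfold homz
  refine continuous_finsetSum _ fun d _ => ?_
  refine (continuous_fst.pow _).mul ?_
  exact (MvPolynomial.continuous_eval _).comp continuous_snd

lemma top_comp_ne {σ : Type*} {F : MvPolynomial σ ℂ} (hF : F ≠ 0) :
    MvPolynomial.homogeneousComponent F.totalDegree F ≠ 0 := by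
  obtain ⟨m, hm, hmd⟩ := Finset.exists_mem_eq_sup F.support
    (MvPolynomial.support_nonempty.2 hF) (fun s => s.sum fun _ e => e)
  intro h
  have := congrArg (MvPolynomial.coeff m) h
  rw [MvPolynomial.coeff_homogeneousComponent] at this
  rw [if_pos] at this
  · exact (MvPolynomial.mem_support_iff.1 hm) (by simpa using this)
  · rw [MvPolynomial.totalDegree, hmd]; rfl

/-- A polynomial with growth at most `(1+‖x‖)^s` has degree at most `s`. -/
lemma degree_le_of_growth {n : ℕ} (F : MvPolynomial (Fin n) ℂ) (s C : ℝ) (hs : 0 ≤ s)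
    (h : ∀ x : Fin n → ℂ, ‖MvPolynomial.eval x F‖ ≤ C * (1 + ‖x‖) ^ s) :
    (F.totalDegree : ℝ) ≤ s := by
  by_contra! hlt
  have hF : F ≠ 0 := by
    rintro rfl
    simp at hlt
    linarith
  obtain ⟨v, hv⟩ : ∃ v, MvPolynomial.eval v
      (MvPolynomial.homogeneousComponent F.totalDegree F) ≠ 0 := by
    by_contra! hcon
    exact top_comp_ne hF (MvPolynomial.funext (by simpa using hcon))
  set D := F.totalDegree
  have hC : 0 ≤ C := by
    have := (norm_nonneg _).trans (h 0)
    simpa using this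
  -- limit
  have h1 : Tendsto (fun t : ℝ => ‖homz F ((t : ℂ))⁻¹ v‖) atTop (nhds ‖homz F 0 v‖) := by
    have hi : Tendsto (fun t : ℝ => ((t : ℂ))⁻¹) atTop (nhds 0) := by
      have := (Complex.continuous_ofReal.tendsto 0).comp tendsto_inv_atTop_zero
      simpa [Function.comp_def] using this
    have hc := ((homz_cont F).tendsto ((0 : ℂ), v))
    have hp : Tendsto (fun t : ℝ => (((t : ℂ))⁻¹, v)) atTop (nhds ((0 : ℂ), v)) :=
      hi.prodMk_nhds tendsto_const_nhds
    exact (hc.comp hp).norm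
  have h2 : Tendsto (fun t : ℝ => C * (2 + ‖v‖) ^ s * t ^ (-(D - s))) atTop (nhds 0) := by
    have := (tendsto_rpow_neg_atTop (show 0 < (D : ℝ) - s by linarith)).const_mul
      (C * (2 + ‖v‖) ^ s)
    simpa using this
  have h3 : ‖homz F 0 v‖ ≤ 0 := by
    refine le_of_tendsto_of_tendsto h1 h2 ?_
    filter_upwards [eventually_ge_atTop (1 : ℝ)] with t ht
    have ht0 : 0 < t := by linarith
    have htc : (t : ℂ) ≠ 0 := by exact_mod_cast ht0.ne'
    have hb := h (fun i => (t : ℂ) * v i)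
    rw [homz_eval F t htc v, norm_mul, norm_pow, Complex.norm_real, Real.norm_of_nonneg ht0.le] at hb
    have hn : ‖(fun i => (t : ℂ) * v i)‖ ≤ t * ‖v‖ := by
      refine (pi_norm_le_iff_of_nonneg (by positivity)).2 fun i => ?_
      rw [norm_mul, Complex.norm_real, Real.norm_of_nonneg ht0.le]
      gcongr
      exact norm_le_pi_norm v i
    have hn2 : (1 + ‖(fun i => (t : ℂ) * v i)‖) ^ s ≤ (2 + ‖v‖) ^ s * t ^ s := by
      rw [← Real.mul_rpow (by positivity) ht0.le]
      refine Real.rpow_le_rpow (by positivity) ?_ hs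
      nlinarith [norm_nonneg v]
    have e1 : t ^ (-((D : ℝ) - s)) = t ^ s / t ^ D := by
      rw [neg_sub, Real.rpow_sub ht0, Real.rpow_natCast]
    rw [e1, ← mul_div_assoc, le_div_iff₀ (by positivity), mul_comm]
    calc _ ≤ _ := hb
      _ ≤ C * ((2 + ‖v‖) ^ s * t ^ s) := by gcongr
      _ = _ := by ring
  rw [homz_zero] at h3
  exact hv (norm_le_zero_iff.1 h3)

/-- if `F(1,c)` top part is nonzero then zeros of `F` lie in a cone. -/
lemma cone_bound {m : ℕ} (F : MvPolynomial (Fin (m + 1)) ℂ) (c : Fin (m + 1) → ℂ) (hc0 : c 0 = 1)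
    (hc : MvPolynomial.eval c (MvPolynomial.homogeneousComponent F.totalDegree F) ≠ 0) :
    ∃ M : ℝ, 0 < M ∧ ∀ w : Fin (m + 1) → ℂ, MvPolynomial.eval w F = 0 →
      ‖w 0‖ ≤ M * (1 + ‖fun i : Fin m => w i.succ - c i.succ * w 0‖) := by
  have hne : ∀ᶠ x : ℂ × (Fin (m + 1) → ℂ) in nhds (0, c), homz F x.1 x.2 ≠ 0 := by
    refine (homz_cont F).continuousAt.eventually_ne ?_
    rw [homz_zero]; exact hc
  obtain ⟨δ, hδ, hb⟩ := Metric.eventually_nhds_iff.1 hne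
  refine ⟨δ⁻¹ * 2, by positivity, fun w hw => ?_⟩
  by_contra! hlt
  set q := ‖fun i : Fin m => w i.succ - c i.succ * w 0‖ with hq
  have hq0 : 0 ≤ q := norm_nonneg _
  have hw0 : 0 < ‖w 0‖ := lt_of_le_of_lt (by positivity) hlt
  have hw0' : w 0 ≠ 0 := norm_pos_iff.1 hw0
  have hlt' : 1 + q < δ * ‖w 0‖ := by
    have : δ * (δ⁻¹ * 2 * (1 + q)) < δ * ‖w 0‖ := by gcongr
    have e : δ * (δ⁻¹ * 2 * (1 + q)) = 2 * (1 + q) := by field_simp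
    linarith
  have hz := homz_eval F (w 0) hw0' (fun i => (w 0)⁻¹ * w i)
  have hz' : (fun i => w 0 * ((w 0)⁻¹ * w i)) = w := by
    funext i; field_simp
  rw [hz', hw] at hz
  have hz2 : homz F (w 0)⁻¹ (fun i => (w 0)⁻¹ * w i) = 0 := by
    rcases mul_eq_zero.1 hz.symm with h | h
    · exact absurd h (pow_ne_zero _ hw0')
    · exact h
  refine hb (y := ((w 0)⁻¹, fun i => (w 0)⁻¹ * w i)) ?_ hz2
  rw [Prod.dist_eq, max_lt_iff]
  constructor
  · rw [dist_zero_right, norm_inv, inv_lt_comm₀ hw0 hδ, inv_lt_iff_one_lt_mul₀ hδ]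
    nlinarith
  · rw [dist_pi_lt_iff hδ]
    intro i
    rw [dist_eq_norm]
    refine Fin.cases ?_ (fun i => ?_) i
    · change ‖(w 0)⁻¹ * w 0 - c 0‖ < δ
      rw [hc0, inv_mul_cancel₀ hw0']; simpa using hδ
    · change ‖(w 0)⁻¹ * w i.succ - c i.succ‖ < δ
      have : (w 0)⁻¹ * w i.succ - c i.succ = (w 0)⁻¹ * (w i.succ - c i.succ * w 0) := by
        field_simp
      rw [this, norm_mul, norm_inv, inv_mul_lt_iff₀ hw0]
      have := norm_le_pi_norm (fun i : Fin m => w i.succ - c i.succ * w 0) i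
      rw [← hq] at this
      nlinarith

lemma prod_coeff_aux {σ B : Type*} [CommRing B] (p : σ → Polynomial B)
    (hp : ∀ i, (p i).natDegree ≤ 1) (e : σ → ℕ) (s : Finset σ) :
    (∏ i ∈ s, p i ^ e i).natDegree ≤ ∑ i ∈ s, e i ∧
    (∏ i ∈ s, p i ^ e i).coeff (∑ i ∈ s, e i) = ∏ i ∈ s, (p i).coeff 1 ^ e i := by
  classical
  induction s using Finset.induction_on with
  | empty => simp
  | insert a s ha ih =>
    rw [Finset.prod_insert ha, Finset.sum_insert ha, Finset.prod_insert ha]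
    have h1 : (p a ^ e a).natDegree ≤ e a := by
      have := Polynomial.natDegree_pow_le_of_le (e a) (hp a)
      simpa using this
    have h2 : (p a ^ e a).coeff (e a) = (p a).coeff 1 ^ e a := by
      have := Polynomial.coeff_pow_of_natDegree_le (m := e a) (hp a)
      simpa using this
    constructor
    · exact Polynomial.natDegree_mul_le_of_le h1 ih.1
    · rw [Polynomial.coeff_mul_add_eq_of_natDegree_le h1 ih.1, h2, ih.2]

lemma aeval_coeff_aux {σ B : Type*} [CommRing B] [Algebra ℂ B] (p : σ → Polynomial B)
    (hp : ∀ i, (p i).natDegree ≤ 1) (F : MvPolynomial σ ℂ) :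
    (MvPolynomial.aeval p F).natDegree ≤ F.totalDegree ∧
    (MvPolynomial.aeval p F).coeff F.totalDegree =
      MvPolynomial.aeval (fun i => (p i).coeff 1)
        (MvPolynomial.homogeneousComponent F.totalDegree F) := by
  have key : ∀ d ∈ F.support, (∑ i ∈ d.support, d i) ≤ F.totalDegree := fun d hd =>
    MvPolynomial.le_totalDegree hd
  rw [MvPolynomial.aeval_def, MvPolynomial.eval₂_eq]
  constructor
  · refine Polynomial.natDegree_sum_le_of_forall_le _ _ fun d hd => ?_
    rw [Polynomial.algebraMap_apply]
    exact (Polynomial.natDegree_C_mul_le _ _).trans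
      ((prod_coeff_aux p hp d d.support).1.trans (key d hd))
  · rw [MvPolynomial.homogeneousComponent_apply, map_sum, Polynomial.finsetSum_coeff,
      Finset.sum_filter]
    refine Finset.sum_congr rfl fun d hd => ?_
    rw [Polynomial.algebraMap_apply, Polynomial.coeff_C_mul]
    split_ifs with h
    · rw [MvPolynomial.aeval_monomial, ← h]
      have := (prod_coeff_aux p hp d d.support).2
      rw [show d.degree = ∑ i ∈ d.support, d i from rfl, this]
      rfl
    · rw [Polynomial.coeff_eq_zero_of_natDegree_lt, mul_zero]
      refine lt_of_le_of_lt (prod_coeff_aux p hp d d.support).1 ?_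
      exact lt_of_le_of_ne (key d hd) h

/-- the coordinate ring. -/
abbrev CR {N : ℕ} (A : Set (EuclideanSpace ℂ (Fin N))) : Type :=
  MvPolynomial (Fin N) ℂ ⧸ vanishIdeal A

/-- the map from a polynomial ring to the coordinate ring. -/
noncomputable def phi {N n : ℕ} (A : Set (EuclideanSpace ℂ (Fin N)))
    (y : Fin n → MvPolynomial (Fin N) ℂ) : MvPolynomial (Fin n) ℂ →ₐ[ℂ] CR A :=
  (Ideal.Quotient.mkₐ ℂ (vanishIdeal A)).comp (MvPolynomial.aeval y)

lemma mem_vanishIdeal {N : ℕ} {A : Set (EuclideanSpace ℂ (Fin N))} {p : MvPolynomial (Fin N) ℂ} :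
    p ∈ vanishIdeal A ↔ ∀ z ∈ A, evalAt z p = 0 := by
  unfold vanishIdeal
  rw [RingHom.mem_ker]
  constructor
  · intro h z hz
    exact congrFun h ⟨z, hz⟩
  · intro h
    funext z
    exact h z.1 z.2

lemma evalAt_aeval {N n : ℕ} (y : Fin n → MvPolynomial (Fin N) ℂ) (F : MvPolynomial (Fin n) ℂ)
    (z : EuclideanSpace ℂ (Fin N)) :
    evalAt z (MvPolynomial.aeval y F) = MvPolynomial.eval (fun j => evalAt z (y j)) F := by
  unfold evalAt
  rw [MvPolynomial.map_aeval]
  simp only [MvPolynomial.algebraMap_eq]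
  rw [show (MvPolynomial.eval fun i => z i).comp MvPolynomial.C = RingHom.id ℂ by ext; simp]
  rfl

lemma integral_step {R B B' : Type*} [CommRing R] [CommRing B] [CommRing B'] (φ : B →+* R)
    (φ' : B' →+* R) (h : φ.IsIntegral) (h' : ∀ b, φ'.IsIntegralElem (φ b)) : φ'.IsIntegral := by
  let _ := φ'.toAlgebra
  intro r
  let ψ : B →+* integralClosure B' R := φ.codRestrict (integralClosure B' R) h'
  obtain ⟨p, hm, hp⟩ := h r
  have : IsIntegral (integralClosure B' R) r := by
    refine ⟨p.map ψ, hm.map ψ, ?_⟩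
    rw [Polynomial.eval₂_map]
    exact hp
  exact isIntegral_trans (R := B') r this

/-- a good (linear, finite, cone-bounded) projection of `A`. -/
structure GoodNN {N : ℕ} (A : Set (EuclideanSpace ℂ (Fin N))) (n : ℕ)
    (y : Fin n → MvPolynomial (Fin N) ℂ) : Prop where
  deg : ∀ j, (y j).totalDegree ≤ 1
  int : (phi A y).toRingHom.IsIntegral
  bd : ∃ C : ℝ, 0 < C ∧ ∀ z ∈ A, ‖z‖ ≤ C * (1 + ‖fun j => evalAt z (y j)‖)

lemma goodNN_base {N : ℕ} (A : Set (EuclideanSpace ℂ (Fin N))) :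
    GoodNN A N MvPolynomial.X where
  deg j := by simp
  int := by
    apply RingHom.IsIntegral.of_finite
    apply RingHom.Finite.of_surjective
    intro r
    obtain ⟨p, rfl⟩ := Ideal.Quotient.mk_surjective r
    exact ⟨p, by simp [phi]⟩
  bd := by
    refine ⟨Real.sqrt N + 1, by positivity, fun z _ => ?_⟩
    have h : ∀ j, ‖z j‖ ≤ ‖fun j => evalAt z (MvPolynomial.X j)‖ := by
      intro j
      have := norm_le_pi_norm (fun j => evalAt z (MvPolynomial.X j)) j
      simpa [evalAt] using this
    set q := ‖fun j => evalAt z (MvPolynomial.X j)‖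
    have hq : 0 ≤ q := norm_nonneg _
    have : ‖z‖ ≤ Real.sqrt N * q := by
      rw [EuclideanSpace.norm_eq]
      calc _ ≤ Real.sqrt (∑ _i : Fin N, q ^ 2) := by
            gcongr with i; exact h i
        _ = _ := by simp [Real.sqrt_mul, Real.sqrt_sq hq]
    nlinarith [Real.sqrt_nonneg N]

lemma goodNN_step {N m : ℕ} (A : Set (EuclideanSpace ℂ (Fin N)))
    (y : Fin (m + 1) → MvPolynomial (Fin N) ℂ) (hy : GoodNN A (m + 1) y)
    (F : MvPolynomial (Fin (m + 1)) ℂ) (hF : F ≠ 0) (hF0 : phi A y F = 0) :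
    ∃ y' : Fin m → MvPolynomial (Fin N) ℂ, GoodNN A m y' := by
  set D := F.totalDegree with hD
  set H := MvPolynomial.homogeneousComponent D F with hH
  have hHh : H.IsHomogeneous D := MvPolynomial.homogeneousComponent_isHomogeneous D F
  obtain ⟨c, hc0, hc⟩ : ∃ c : Fin (m + 1) → ℂ, c 0 = 1 ∧ MvPolynomial.eval c H ≠ 0 := by
    have hne : H * MvPolynomial.X 0 ≠ 0 := mul_ne_zero (top_comp_ne hF) (MvPolynomial.X_ne_zero 0)
    obtain ⟨v, hv⟩ : ∃ v, MvPolynomial.eval v (H * MvPolynomial.X 0) ≠ 0 := by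
      by_contra! hcon
      exact hne (MvPolynomial.funext (by simpa using hcon))
    rw [map_mul, MvPolynomial.eval_X] at hv
    have hv0 := right_ne_zero_of_mul hv
    refine ⟨fun i => (v 0)⁻¹ * v i, inv_mul_cancel₀ hv0, ?_⟩
    rw [hom_scale hHh]
    exact mul_ne_zero (pow_ne_zero _ (inv_ne_zero hv0)) (left_ne_zero_of_mul hv)
  let y' : Fin m → MvPolynomial (Fin N) ℂ := fun i => y i.succ - MvPolynomial.C (c i.succ) * y 0
  refine ⟨y', ?_, ?_, ?_⟩
  · intro j
    refine (MvPolynomial.totalDegree_sub _ _).trans (max_le (hy.deg _) ?_)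
    refine (MvPolynomial.totalDegree_mul _ _).trans ?_
    simpa using hy.deg 0
  · -- integrality
    have hC : ∀ a : ℂ, (phi A y').toRingHom.IsIntegralElem (algebraMap ℂ (CR A) a) := by
      intro a
      have : algebraMap ℂ (CR A) a = (phi A y').toRingHom (algebraMap ℂ _ a) :=
        ((phi A y').commutes a).symm
      rw [this]
      exact RingHom.isIntegralElem_map _
    have hsucc : ∀ i : Fin m, (phi A y).toRingHom (MvPolynomial.X i.succ) =
          (phi A y').toRingHom (MvPolynomial.X i) +
          algebraMap ℂ (CR A) (c i.succ) * phi A y (MvPolynomial.X 0) := by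
      intro i
      have : algebraMap ℂ (CR A) (c i.succ) =
        Ideal.Quotient.mk (vanishIdeal A) (MvPolynomial.C (c i.succ)) := rfl
      rw [this]
      simp [phi, y']
    have h0 : (phi A y').toRingHom.IsIntegralElem (phi A y (MvPolynomial.X 0)) := by
      let p : Fin (m + 1) → Polynomial (MvPolynomial (Fin m) ℂ) :=
        Fin.cons Polynomial.X (fun i => Polynomial.C (MvPolynomial.X i) +
          Polynomial.C (MvPolynomial.C (c i.succ)) * Polynomial.X)
      have hp : ∀ i, (p i).natDegree ≤ 1 := by
        intro i
        refine Fin.cases ?_ (fun i => ?_) i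
        · simp [p]
        · simp only [p, Fin.cons_succ]
          compute_degree
      have hp1 : (fun i => (p i).coeff 1) = fun i => MvPolynomial.C (c i) := by
        funext i
        refine Fin.cases ?_ (fun i => ?_) i
        · simp [p, hc0]
        · simp [p, Polynomial.coeff_C]
      obtain ⟨g1, g2⟩ := aeval_coeff_aux p hp F
      set G := MvPolynomial.aeval p F
      have g3 : G.coeff D = MvPolynomial.C (MvPolynomial.eval c H) := by
        rw [g2, hp1]
        have := MvPolynomial.map_aeval (R := ℂ) c (MvPolynomial.C (σ := Fin m) (R := ℂ)) H
        rw [← MvPolynomial.coe_aeval_eq_eval]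
        exact this.symm
      refine ⟨Polynomial.C (MvPolynomial.C (MvPolynomial.eval c H)⁻¹) * G, ?_, ?_⟩
      · refine Polynomial.monic_of_natDegree_le_of_coeff_eq_one D
          ((Polynomial.natDegree_C_mul_le _ _).trans g1) ?_
        rw [Polynomial.coeff_C_mul, g3, ← MvPolynomial.C_mul, inv_mul_cancel₀ hc, MvPolynomial.C_1]
      · rw [Polynomial.eval₂_mul]
        have : Polynomial.eval₂ (phi A y').toRingHom (phi A y (MvPolynomial.X 0)) G = 0 := by
          have hcomp : (Polynomial.eval₂RingHom (phi A y').toRingHom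
              (phi A y (MvPolynomial.X 0))).comp (MvPolynomial.aeval (R := ℂ) p).toRingHom =
              (phi A y).toRingHom := by
            apply MvPolynomial.ringHom_ext
            · intro a
              have h1 := (phi A y').commutes a
              have h2 := (phi A y).commutes a
              simp only [MvPolynomial.algebraMap_eq] at h1 h2
              simp [Polynomial.algebraMap_apply, h1, h2]
            · intro i
              refine Fin.cases ?_ (fun i => ?_) i
              · simp [p]
              · have h1 := (phi A y').commutes (c i.succ)
                simp only [MvPolynomial.algebraMap_eq] at h1
                have := hsucc i
                simp only [AlgHom.toRingHom_eq_coe, RingHom.coe_coe] at this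
                simp [p, this, h1]
          rw [← hF0]
          exact congrArg (fun f : _ →+* _ => f F) hcomp
        rw [this, mul_zero]
    refine integral_step (phi A y).toRingHom _ hy.int fun b => ?_
    induction b using MvPolynomial.induction_on with
    | C a =>
      have := hC a
      rwa [← (phi A y).commutes a] at this
    | add p q hp hq => rw [map_add]; exact hp.add _ hq
    | mul_X p i hp =>
      rw [map_mul]
      refine hp.mul _ ?_
      refine Fin.cases h0 (fun i => ?_) i
      rw [hsucc]
      exact (RingHom.isIntegralElem_map _).add _ ((hC _).mul _ h0)
  · obtain ⟨C, hCpos, hCb⟩ := hy.bd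
    obtain ⟨M, hM, hMb⟩ := cone_bound F c hc0 hc
    set L := ‖c‖ with hL
    refine ⟨C * (2 + M + L * M), by positivity, fun z hz => (hCb z hz).trans ?_⟩
    have hFz : MvPolynomial.eval (fun j => evalAt z (y j)) F = 0 := by
      rw [← evalAt_aeval]
      exact mem_vanishIdeal.1 (Ideal.Quotient.eq_zero_iff_mem.1 hF0) z hz
    have hw := hMb _ hFz
    have e : (fun i : Fin m => evalAt z (y i.succ) - c i.succ * evalAt z (y 0)) =
        fun j => evalAt z (y' j) := by
      funext j; simp [y', evalAt]
    rw [e] at hw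
    set q := ‖fun j => evalAt z (y' j)‖ with hq
    have hq0 : 0 ≤ q := norm_nonneg _
    have hLn : 0 ≤ L := norm_nonneg _
    have : ‖fun j => evalAt z (y j)‖ ≤ q + (1 + L) * (M * (1 + q)) := by
      refine (pi_norm_le_iff_of_nonneg (by positivity)).2 fun i => ?_
      refine Fin.cases ?_ (fun i => ?_) i
      · have : 0 ≤ L * (M * (1 + q)) := by positivity
        linarith
      · have e2 : evalAt z (y i.succ) = evalAt z (y' i) + c i.succ * evalAt z (y 0) := by
          simp [y', evalAt]
        rw [e2]
        refine (norm_add_le _ _).trans ?_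
        rw [norm_mul]
        have h1 := norm_le_pi_norm (fun j => evalAt z (y' j)) i
        have h2 : ‖c i.succ‖ ≤ L := norm_le_pi_norm c _
        have h3 : ‖c i.succ‖ * ‖evalAt z (y 0)‖ ≤ L * (M * (1 + q)) := by gcongr
        have : 0 ≤ M * (1 + q) := by positivity
        rw [← hq] at h1
        linarith
    calc _ ≤ C * (1 + (q + (1 + L) * (M * (1 + q)))) := by gcongr
      _ ≤ _ := by
        rw [mul_assoc]
        gcongr
        nlinarith

lemma exists_NN {N : ℕ} (A : Set (EuclideanSpace ℂ (Fin N)))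
    (hprime : (vanishIdeal A).IsPrime) :
    ∃ (n : ℕ) (y : Fin n → MvPolynomial (Fin N) ℂ), GoodNN A n y ∧
      Function.Injective (phi A y) := by
  classical
  have hex : ∃ n, ∃ y : Fin n → MvPolynomial (Fin N) ℂ, GoodNN A n y := ⟨N, _, goodNN_base A⟩
  obtain ⟨y, hy⟩ := Nat.find_spec hex
  have hmin : ∀ k < Nat.find hex, ¬ ∃ y : Fin k → MvPolynomial (Fin N) ℂ, GoodNN A k y :=
    fun k hk => Nat.find_min hex hk
  generalize Nat.find hex = n at y hy hmin
  refine ⟨n, y, hy, ?_⟩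
  rw [injective_iff_map_eq_zero]
  intro F hF0
  by_contra hF
  cases n with
  | zero =>
    have : Nontrivial (CR A) := Ideal.Quotient.nontrivial_iff.2 hprime.ne_top
    rw [MvPolynomial.eq_C_of_isEmpty F] at hF0 hF
    have h2 := (phi A y).commutes (MvPolynomial.coeff 0 F)
    rw [MvPolynomial.algebraMap_eq, hF0] at h2
    have : MvPolynomial.coeff 0 F = 0 := by
      by_contra hne
      exact hne ((map_eq_zero (algebraMap ℂ (CR A))).1 h2.symm)
    exact hF (by rw [this]; simp)
  | succ m => exact hmin m (Nat.lt_succ_self m) (goodNN_step A y hy F hF hF0)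

lemma exists_point {N : ℕ} {A : Set (EuclideanSpace ℂ (Fin N))} (halg : IsAlgebraicSet A)
    (M : Ideal (CR A)) (hM : M.IsMaximal) :
    ∃ z ∈ A, ∀ p : MvPolynomial (Fin N) ℂ, Ideal.Quotient.mk (vanishIdeal A) p ∈ M →
      evalAt z p = 0 := by
  have hM' : (M.comap (Ideal.Quotient.mk (vanishIdeal A))).IsMaximal :=
    Ideal.comap_isMaximal_of_surjective _ Ideal.Quotient.mk_surjective
  obtain ⟨x, hx⟩ := (MvPolynomial.isMaximal_iff_eq_vanishingIdeal_singleton (K := ℂ)).1 hM'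
  have key : ∀ p : MvPolynomial (Fin N) ℂ, Ideal.Quotient.mk (vanishIdeal A) p ∈ M →
      evalAt (WithLp.toLp 2 x) p = 0 := by
    intro p hp
    have : p ∈ M.comap (Ideal.Quotient.mk (vanishIdeal A)) := hp
    rw [hx, MvPolynomial.mem_vanishingIdeal_singleton_iff] at this
    simpa [evalAt, MvPolynomial.coe_aeval_eq_eval] using this
  refine ⟨WithLp.toLp 2 x, ?_, key⟩
  obtain ⟨S, hS⟩ := halg
  have : ∀ p ∈ S, evalAt (WithLp.toLp 2 x) p = 0 := by
    intro p hp
    apply key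
    have : p ∈ vanishIdeal A := by
      rw [mem_vanishIdeal]
      intro z hz
      rw [hS] at hz
      exact hz p hp
    rw [Ideal.Quotient.eq_zero_iff_mem.2 this]
    exact M.zero_mem
  rw [hS]
  exact this

lemma lying_aux {B R : Type*} [CommRing B] [IsDomain B] [IsIntegrallyClosed B] [CommRing R]
    [IsDomain R] [Algebra B R] [Module.IsTorsionFree B R] [Algebra.IsIntegral B R]
    (ε : B →+* ℂ) (hε : Function.Surjective ε) (f : R) (l : ℂ)
    (hl : Polynomial.eval₂ ε l (minpoly B f) = 0) :
    ∃ Q : Ideal R, Q.IsMaximal ∧ (∀ b, ε b = 0 → algebraMap B R b ∈ Q) ∧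
      ∀ b, ε b = l → f - algebraMap B R b ∈ Q := by
  have hf : IsIntegral B f := Algebra.IsIntegral.isIntegral f
  let S := Algebra.adjoin B {f}
  let e := minpoly.equivAdjoin hf
  let g : S →+* ℂ := (AdjoinRoot.lift ε l hl).comp (e.symm : S →+* _)
  have hgb : ∀ b, g (algebraMap B S b) = ε b := by
    intro b
    have : e.symm (algebraMap B S b) = AdjoinRoot.of _ b := e.symm.commutes b
    simp only [g, RingHom.comp_apply, RingHom.coe_coe]
    rw [this]
    exact AdjoinRoot.lift_of hl
  have hgf : g ⟨f, Algebra.self_mem_adjoin_singleton _ f⟩ = l := by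
    have : e.symm ⟨f, Algebra.self_mem_adjoin_singleton _ f⟩ = AdjoinRoot.root _ := by
      rw [AlgEquiv.symm_apply_eq]
      simp [e, AdjoinRoot.Minpoly.coe_toAdjoin]
    simp only [g, RingHom.comp_apply, RingHom.coe_coe]
    rw [this]
    exact AdjoinRoot.lift_root hl
  have hgs : Function.Surjective g := fun a => by
    obtain ⟨b, rfl⟩ := hε a
    exact ⟨_, hgb b⟩
  have hker : (RingHom.ker g).IsMaximal := RingHom.ker_isMaximal_of_surjective g hgs
  have : Algebra.IsIntegral S R := Algebra.IsIntegral.tower_top B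
  obtain ⟨Q, hQ, hQc⟩ := Ideal.exists_ideal_over_maximal_of_isIntegral (S := R)
    (RingHom.ker g) (by
      rw [(RingHom.injective_iff_ker_eq_bot _).1 Subtype.val_injective]
      exact bot_le)
  refine ⟨Q, hQ, fun b hb => ?_, fun b hb => ?_⟩
  · have h1 : algebraMap B S b ∈ RingHom.ker g := by
      rw [RingHom.mem_ker, hgb, hb]
    rw [← hQc] at h1
    exact h1
  · have h1 : (⟨f, Algebra.self_mem_adjoin_singleton _ f⟩ : S) -
        algebraMap B S b ∈ RingHom.ker g := by
      rw [RingHom.mem_ker, map_sub, hgb, hgf, hb, sub_self]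
    rw [← hQc] at h1
    exact h1

lemma lying_aux2 {B R : Type*} [CommRing B] [IsDomain B] [IsIntegrallyClosed B] [CommRing R]
    [IsDomain R] (φ : B →+* R) (hφ : Function.Injective φ) (hi : φ.IsIntegral) (f : R) :
    ∃ χ : Polynomial B, χ.Monic ∧ χ ≠ 1 ∧ Polynomial.eval₂ φ f χ = 0 ∧
    ∀ (ε : B →+* ℂ) (_ : Function.Surjective ε) (l : ℂ) (_ : Polynomial.eval₂ ε l χ = 0),
    ∃ Q : Ideal R, Q.IsMaximal ∧ (∀ b, ε b = 0 → φ b ∈ Q) ∧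
      ∀ b, ε b = l → f - φ b ∈ Q := by
  let _ : Algebra B R := φ.toAlgebra
  have hI : Algebra.IsIntegral B R := ⟨hi⟩
  have : Module.IsTorsionFree B R := Module.isTorsionFree_iff_algebraMap_injective.2 hφ
  have hf : IsIntegral B f := hI.isIntegral f
  exact ⟨minpoly _ f, minpoly.monic hf, minpoly.ne_one _ _, minpoly.aeval _ f,
    fun ε hε l hl => lying_aux ε hε f l hl⟩

lemma exists_chi {N n : ℕ} (A : Set (EuclideanSpace ℂ (Fin N))) (halg : IsAlgebraicSet A)
    (hprime : (vanishIdeal A).IsPrime) (y : Fin n → MvPolynomial (Fin N) ℂ) (hy : GoodNN A n y)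
    (hinj : Function.Injective (phi A y)) (f : MvPolynomial (Fin N) ℂ) :
    ∃ χ : Polynomial (MvPolynomial (Fin n) ℂ), χ.Monic ∧ χ ≠ 1 ∧
      Polynomial.eval₂ (phi A y).toRingHom (Ideal.Quotient.mk (vanishIdeal A) f) χ = 0 ∧
      ∀ (x : Fin n → ℂ) (l : ℂ), Polynomial.eval₂ (MvPolynomial.eval x) l χ = 0 →
        ∃ z ∈ A, (∀ j, evalAt z (y j) = x j) ∧ evalAt z f = l := by
  have : IsDomain (CR A) := Ideal.Quotient.isDomain (vanishIdeal A)
  obtain ⟨χ, hm, h1, h0, h⟩ := lying_aux2 (phi A y).toRingHom hinj hy.int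
    (Ideal.Quotient.mk (vanishIdeal A) f)
  refine ⟨χ, hm, h1, h0, fun x l hl => ?_⟩
  obtain ⟨Q, hQ, hQ1, hQ2⟩ := h (MvPolynomial.eval x)
    (fun a => ⟨MvPolynomial.C a, MvPolynomial.eval_C a⟩) l hl
  obtain ⟨z, hz, hzp⟩ := exists_point halg Q hQ
  refine ⟨z, hz, fun j => ?_, ?_⟩
  · have h1 := hQ1 (MvPolynomial.X j - MvPolynomial.C (x j)) (by simp)
    have h2 := hzp (MvPolynomial.aeval y (MvPolynomial.X j - MvPolynomial.C (x j))) h1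
    simpa [evalAt, sub_eq_zero] using h2
  · have h1 := hQ2 (MvPolynomial.C l) (by simp)
    have h2 := hzp (f - MvPolynomial.aeval y (MvPolynomial.C l)) (by
      rw [map_sub]; exact h1)
    simpa [evalAt, sub_eq_zero] using h2

lemma chi_eval {N n : ℕ} {A : Set (EuclideanSpace ℂ (Fin N))}
    {y : Fin n → MvPolynomial (Fin N) ℂ} {f : MvPolynomial (Fin N) ℂ}
    {χ : Polynomial (MvPolynomial (Fin n) ℂ)}
    (h : Polynomial.eval₂ (phi A y).toRingHom (Ideal.Quotient.mk (vanishIdeal A) f) χ = 0) :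
    ∀ z ∈ A, Polynomial.eval₂ (MvPolynomial.eval (fun j => evalAt z (y j))) (evalAt z f) χ = 0 := by
  intro z hz
  have h1 : (phi A y).toRingHom =
    (Ideal.Quotient.mk (vanishIdeal A)).comp (MvPolynomial.aeval (R := ℂ) y).toRingHom := rfl
  rw [h1, ← Polynomial.hom_eval₂, Ideal.Quotient.eq_zero_iff_mem, mem_vanishIdeal] at h
  have h2 := h z hz
  unfold evalAt at h2
  rw [Polynomial.hom_eval₂] at h2
  have h3 : (MvPolynomial.eval fun i => z i).comp (MvPolynomial.aeval (R := ℂ) y).toRingHom =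
      MvPolynomial.eval (fun j => evalAt z (y j)) := by
    apply RingHom.ext
    intro F
    exact evalAt_aeval y F z
  rw [h3] at h2
  exact h2

lemma evalAt_cont {N : ℕ} (p : MvPolynomial (Fin N) ℂ) :
    Continuous (fun z : EuclideanSpace ℂ (Fin N) => evalAt z p) := by
  unfold evalAt
  exact (MvPolynomial.continuous_eval p).comp (PiLp.continuous_ofLp 2 _)

lemma bounded_ball {N : ℕ} (p : MvPolynomial (Fin N) ℂ) (R : ℝ) :
    ∃ M : ℝ, 0 < M ∧ ∀ z : EuclideanSpace ℂ (Fin N), ‖z‖ ≤ R → ‖evalAt z p‖ ≤ M := by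
  obtain ⟨M, hM⟩ := (isCompact_closedBall (0 : EuclideanSpace ℂ (Fin N)) R).exists_bound_of_continuousOn
    (evalAt_cont p).continuousOn
  refine ⟨max M 1, by positivity, fun z hz => (hM z (by simpa using hz)).trans (le_max_left _ _)⟩

lemma A_unbounded {N : ℕ} (A : Set (EuclideanSpace ℂ (Fin N))) (halg : IsAlgebraicSet A)
    (hprime : (vanishIdeal A).IsPrime) (hinf : A.Infinite) (R : ℝ) : ∃ z ∈ A, R < ‖z‖ := by
  obtain ⟨n, y, hy, hinj⟩ := exists_NN A hprime
  cases n with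
  | zero =>
    exfalso
    choose χ hm h1 h0 hr using fun i : Fin N =>
      exists_chi A halg hprime y hy hinj (MvPolynomial.X i)
    let x : Fin 0 → ℂ := fun j => j.elim0
    let T : Fin N → Set ℂ := fun i => {l | ((χ i).map (MvPolynomial.eval x)).IsRoot l}
    have hT : ∀ i, (T i).Finite := fun i =>
      Polynomial.finite_setOfPred_isRoot ((hm i).map _).ne_zero
    have hfin : (Set.univ.pi T).Finite := Set.Finite.pi' hT |>.subset (by
      intro v hv; simpa using hv)
    apply hinf
    refine (hfin.preimage (f := fun z : EuclideanSpace ℂ (Fin N) => fun i => z i) ?_).subset ?_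
    · intro a _ b _ hab
      ext i
      exact congrFun hab i
    · intro z hz i _
      have := chi_eval (h0 i) z hz
      rw [show (fun j => evalAt z (y j)) = x from funext fun j => j.elim0] at this
      simp only [T, Set.mem_ofPred_eq, Polynomial.IsRoot, Polynomial.eval_map]
      simpa [evalAt] using this
  | succ m =>
    by_contra! hcon
    obtain ⟨M, hM, hMb⟩ := bounded_ball (y 0) R
    obtain ⟨χ, hm, h1, h0, hr⟩ := exists_chi A halg hprime y hy hinj 0
    let x : Fin (m + 1) → ℂ := fun _ => ((M + 1 : ℝ) : ℂ)
    obtain ⟨l, hl⟩ := IsAlgClosed.exists_root (χ.map (MvPolynomial.eval x)) (by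
      rw [hm.degree_map]
      intro hd
      exact h1 (hm.natDegree_eq_zero.1 (Polynomial.natDegree_eq_of_degree_eq_some hd)))
    rw [Polynomial.IsRoot, Polynomial.eval_map] at hl
    obtain ⟨z, hz, hzy, -⟩ := hr x l hl
    have h2 := hMb z (hcon z hz)
    rw [hzy 0, Complex.norm_real, Real.norm_of_nonneg (by positivity)] at h2
    linarith

lemma totalDegree_aeval_le {N n : ℕ} (y : Fin n → MvPolynomial (Fin N) ℂ)
    (hy : ∀ j, (y j).totalDegree ≤ 1) (F : MvPolynomial (Fin n) ℂ) :
    (MvPolynomial.aeval y F).totalDegree ≤ F.totalDegree := by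
  rw [MvPolynomial.aeval_def, MvPolynomial.eval₂_eq]
  refine MvPolynomial.totalDegree_finsetSum_le fun d hd => ?_
  refine (MvPolynomial.totalDegree_mul _ _).trans ?_
  rw [MvPolynomial.algebraMap_eq, MvPolynomial.totalDegree_C, zero_add]
  refine (MvPolynomial.totalDegree_finsetProd _ _).trans ?_
  refine le_trans ?_ (MvPolynomial.le_totalDegree hd)
  refine Finset.sum_le_sum fun i _ => ?_
  refine (MvPolynomial.totalDegree_pow _ _).trans ?_
  calc _ ≤ d i * 1 := Nat.mul_le_mul_left _ (hy i)
    _ = _ := mul_one _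

lemma key_chi {N n : ℕ} (A : Set (EuclideanSpace ℂ (Fin N)))
    (y : Fin n → MvPolynomial (Fin N) ℂ) (hy : GoodNN A n y)
    (f : MvPolynomial (Fin N) ℂ) (ρ : ℝ) (hρ : 0 ≤ ρ)
    (h : ∀ s > ρ, ∃ C : ℝ, ∀ z ∈ A, ‖evalAt z f‖ ≤ C * (1 + ‖z‖) ^ s)
    (χ : Polynomial (MvPolynomial (Fin n) ℂ)) (hm : χ.Monic)
    (hr : ∀ (x : Fin n → ℂ) (l : ℂ), Polynomial.eval₂ (MvPolynomial.eval x) l χ = 0 →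
        ∃ z ∈ A, (∀ j, evalAt z (y j) = x j) ∧ evalAt z f = l) (i : ℕ) :
    ((χ.coeff i).totalDegree : ℝ) ≤ ρ * (χ.natDegree - i : ℕ) := by
  have hlim : Tendsto (fun s : ℝ => s * ((χ.natDegree - i : ℕ) : ℝ)) (nhdsWithin ρ (Set.Ioi ρ))
      (nhds (ρ * (χ.natDegree - i : ℕ))) :=
    ((continuous_id.mul continuous_const).tendsto ρ).mono_left nhdsWithin_le_nhds
  refine ge_of_tendsto hlim ?_
  filter_upwards [self_mem_nhdsWithin] with s hs
  have hs' : ρ < s := hs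
  obtain ⟨C1, hC1⟩ := h s hs
  obtain ⟨C2, hC2, hbd⟩ := hy.bd
  set k := χ.natDegree - i with hk
  have hs0 : 0 ≤ s := by linarith
  refine degree_le_of_growth _ _ ((max C1 0 * (1 + C2) ^ s) ^ k * χ.natDegree.choose i)
    (by positivity) fun x => ?_
  have hroot : ∀ l ∈ (χ.map (MvPolynomial.eval x)).roots,
      ‖l‖ ≤ (max C1 0 * (1 + C2) ^ s) * (1 + ‖x‖) ^ s := by
    intro l hl
    have hl' := Polynomial.isRoot_of_mem_roots hl
    rw [Polynomial.IsRoot, Polynomial.eval_map] at hl'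
    obtain ⟨z, hz, hzy, rfl⟩ := hr x l hl'
    refine (hC1 z hz).trans ?_
    have h1 := hbd z hz
    rw [show (fun j => evalAt z (y j)) = x from funext hzy] at h1
    have h2 : 1 + ‖z‖ ≤ (1 + C2) * (1 + ‖x‖) := by
      nlinarith [norm_nonneg x]
    calc C1 * (1 + ‖z‖) ^ s ≤ max C1 0 * ((1 + C2) * (1 + ‖x‖)) ^ s := by
          gcongr
          exact le_max_left _ _
      _ = _ := by rw [Real.mul_rpow (by positivity) (by positivity)]; ring
  have := Polynomial.coeff_le_of_roots_le i hm (IsAlgClosed.splits _) hroot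
  rw [Polynomial.coeff_map] at this
  refine this.trans (le_of_eq ?_)
  rw [mul_pow _ ((1 + ‖x‖) ^ s), Real.rpow_mul (by positivity), Real.rpow_natCast]
  ring

lemma key_powers {N : ℕ} (A : Set (EuclideanSpace ℂ (Fin N))) (halg : IsAlgebraicSet A)
    (hprime : (vanishIdeal A).IsPrime) (f : MvPolynomial (Fin N) ℂ) (ρ : ℝ) (hρ : 0 ≤ ρ)
    (h : ∀ s > ρ, ∃ C : ℝ, ∀ z ∈ A, ‖evalAt z f‖ ≤ C * (1 + ‖z‖) ^ s) :
    ∃ C0 : ℝ, 0 ≤ C0 ∧ ∀ k : ℕ, ∃ P : MvPolynomial (Fin N) ℂ,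
      (∀ z ∈ A, evalAt z P = evalAt z f ^ k) ∧ (P.totalDegree : ℝ) ≤ k * ρ + C0 := by
  obtain ⟨n, y, hy, hinj⟩ := exists_NN A hprime
  obtain ⟨χ, hm, -, h0, hr⟩ := exists_chi A halg hprime y hy hinj f
  have hdeg := key_chi A y hy f ρ hρ h χ hm hr
  set m := χ.natDegree with hmdef
  refine ⟨(m * f.totalDegree : ℕ), by positivity, fun k => ?_⟩
  induction k using Nat.strong_induction_on with
  | _ k ih =>
    rcases lt_or_ge k m with hk | hk
    · refine ⟨f ^ k, fun z _ => by simp [evalAt], ?_⟩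
      have h1 : (f ^ k).totalDegree ≤ m * f.totalDegree :=
        (MvPolynomial.totalDegree_pow _ _).trans (Nat.mul_le_mul_right _ hk.le)
      have h2 : ((f ^ k).totalDegree : ℝ) ≤ (m * f.totalDegree : ℕ) := by exact_mod_cast h1
      have : 0 ≤ k * ρ := by positivity
      linarith
    · have ih' : ∀ i : Fin m, ∃ P : MvPolynomial (Fin N) ℂ,
          (∀ z ∈ A, evalAt z P = evalAt z f ^ (k - m + i)) ∧
          (P.totalDegree : ℝ) ≤ (k - m + i : ℕ) * ρ + (m * f.totalDegree : ℕ) := fun i =>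
        ih (k - m + i) (by have := i.2; omega)
      choose P hP1 hP2 using ih'
      refine ⟨-∑ i : Fin m, MvPolynomial.aeval y (χ.coeff i) * P i, fun z hz => ?_, ?_⟩
      · have h1 := chi_eval h0 z hz
        rw [Polynomial.eval₂_eq_sum_range, ← hmdef, Finset.sum_range_succ, hm.coeff_natDegree] at h1
        have h2 : evalAt z (-∑ i : Fin m, MvPolynomial.aeval y (χ.coeff i) * P i) =
            -∑ i : Fin m, evalAt z (MvPolynomial.aeval y (χ.coeff i)) * evalAt z (P i) := by
          simp only [evalAt, map_neg, map_sum, map_mul]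
        rw [h2]
        have h3 : ∀ i : Fin m, evalAt z (MvPolynomial.aeval y (χ.coeff i)) * evalAt z (P i) =
            evalAt z f ^ (k - m) * (MvPolynomial.eval (fun j => evalAt z (y j)) (χ.coeff i) *
              evalAt z f ^ (i : ℕ)) := by
          intro i
          rw [evalAt_aeval, hP1 i z hz, pow_add]; ring
        rw [Finset.sum_congr rfl fun i _ => h3 i, ← Finset.mul_sum,
          Fin.sum_univ_eq_sum_range (fun i => MvPolynomial.eval (fun j => evalAt z (y j))
            (χ.coeff i) * evalAt z f ^ i) m, eq_neg_of_add_eq_zero_left h1]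
        rw [map_one, one_mul, mul_neg, neg_neg, ← pow_add]
        congr 1; omega
      · rw [MvPolynomial.totalDegree_neg]
        have hfl : (0 : ℝ) ≤ k * ρ + (m * f.totalDegree : ℕ) := by positivity
        rw [← Nat.le_floor_iff hfl]
        refine MvPolynomial.totalDegree_finsetSum_le fun i _ => ?_
        rw [Nat.le_floor_iff hfl]
        have h1 := (MvPolynomial.totalDegree_mul (MvPolynomial.aeval y (χ.coeff i)) (P i)).trans
          (Nat.add_le_add_right (totalDegree_aeval_le y hy.deg (χ.coeff i)) _)
        have h2 : ((MvPolynomial.aeval y (χ.coeff i) * P i).totalDegree : ℝ) ≤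
          (χ.coeff i).totalDegree + (P i).totalDegree := by exact_mod_cast h1
        have h3 := hdeg i
        have h4 := hP2 i
        have h5 : (k : ℝ) = ((m - i : ℕ) : ℝ) + ((k - m + i : ℕ) : ℝ) := by
          have := i.2
          norm_cast; omega
        rw [h5]
        linarith

lemma ev_atInftyOn {E : Type*} [Norm E] {V : Set E} {P : E → Prop} :
    (∀ᶠ z in atInftyOn V, P z) ↔ ∃ R : ℝ, ∀ z ∈ V, R ≤ ‖z‖ → P z := by
  unfold atInftyOn
  rw [Filter.eventually_inf_principal, Filter.eventually_comap, Filter.eventually_atTop]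
  constructor
  · rintro ⟨R, h⟩
    exact ⟨R, fun z hz hR => h _ hR z rfl hz⟩
  · rintro ⟨R, h⟩
    refine ⟨R, fun b hb z hz hzV => h z hzV (by rw [hz]; exact hb)⟩

lemma freq_atInftyOn {E : Type*} [Norm E] {V : Set E} {P : E → Prop}
    (h : ∀ R : ℝ, ∃ z ∈ V, R ≤ ‖z‖ ∧ P z) : ∃ᶠ z in atInftyOn V, P z := by
  intro hev
  obtain ⟨R, hR⟩ := ev_atInftyOn.1 hev
  obtain ⟨z, hz, h1, h2⟩ := h R
  exact hR z hz h1 h2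

lemma logRatio_le_iff {E : Type*} [Norm E] (f : E → ℂ) (z : E) (hz : 1 < ‖z‖) (s : ℝ) :
    logRatio f z ≤ (s : EReal) ↔ ‖f z‖ ≤ ‖z‖ ^ s := by
  have hL := Real.log_pos hz
  have hz0 : 0 < ‖z‖ := by linarith
  unfold logRatio elog
  rw [if_neg hz0.ne']
  by_cases hf : ‖f z‖ = 0
  · rw [if_pos hf, EReal.bot_div_of_pos_ne_top (by exact_mod_cast hL) (EReal.coe_ne_top _), hf]
    simp only [bot_le, true_iff]
    positivity
  · have hf' : 0 < ‖f z‖ := lt_of_le_of_ne (norm_nonneg _) (Ne.symm hf)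
    rw [if_neg hf, ← EReal.coe_div, EReal.coe_le_coe_iff, div_le_iff₀ hL,
      ← Real.log_rpow hz0, Real.log_le_log_iff hf' (by positivity)]

lemma le_logRatio {E : Type*} [Norm E] (f : E → ℂ) (z : E) (hz : 1 < ‖z‖) (s : ℝ)
    (h : ‖z‖ ^ s ≤ ‖f z‖) : (s : EReal) ≤ logRatio f z := by
  have hL := Real.log_pos hz
  have hz0 : 0 < ‖z‖ := by linarith
  have hf' : 0 < ‖f z‖ := lt_of_lt_of_le (by positivity) h
  unfold logRatio elog
  rw [if_neg hz0.ne', if_neg hf'.ne', ← EReal.coe_div, EReal.coe_le_coe_iff, le_div_iff₀ hL,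
      ← Real.log_rpow hz0, Real.log_le_log_iff (by positivity) hf']
  exact h

lemma bound_of_growth {E : Type*} [Norm E] {f : E → ℂ} {V : Set E} {s : ℝ}
    (h : growthExp f V < (s : EReal)) : ∃ R : ℝ, ∀ z ∈ V, R ≤ ‖z‖ → ‖f z‖ ≤ ‖z‖ ^ s := by
  have := Filter.eventually_lt_of_limsup_lt h
  obtain ⟨R, hR⟩ := ev_atInftyOn.1 this
  refine ⟨max R 2, fun z hz hRz => ?_⟩
  have h1 : R ≤ ‖z‖ := (le_max_left _ _).trans hRz
  have h2 : (2 : ℝ) ≤ ‖z‖ := (le_max_right _ _).trans hRz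
  exact (logRatio_le_iff f z (by linarith) s).1 (hR z hz h1).le

lemma growth_le {E : Type*} [Norm E] {f : E → ℂ} {V : Set E} {d C R : ℝ}
    (h : ∀ z ∈ V, R ≤ ‖z‖ → ‖f z‖ ≤ C * ‖z‖ ^ d) : growthExp f V ≤ (d : EReal) := by
  refine EReal.le_of_forall_lt_iff_le.1 fun s hs => ?_
  have hs' : d < s := by exact_mod_cast hs
  refine Filter.limsup_le_of_le (by isBoundedDefault) ?_
  rw [ev_atInftyOn]
  have ht := tendsto_rpow_atTop (show 0 < s - d by linarith)
  obtain ⟨R', hR'⟩ := Filter.eventually_atTop.1 (ht.eventually_ge_atTop C)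
  refine ⟨max (max R R') 2, fun z hz hRz => ?_⟩
  have h1 : R ≤ ‖z‖ := ((le_max_left _ _).trans (le_max_left _ _)).trans hRz
  have h2 : (2 : ℝ) ≤ ‖z‖ := (le_max_right _ _).trans hRz
  have h3 : R' ≤ ‖z‖ := ((le_max_right _ _).trans (le_max_left _ _)).trans hRz
  have hz0 : 0 < ‖z‖ := by linarith
  rw [logRatio_le_iff f z (by linarith) s]
  refine (h z hz h1).trans ?_
  calc _ ≤ ‖z‖ ^ (s - d) * ‖z‖ ^ d := by gcongr; exact hR' _ h3
    _ = _ := by rw [← Real.rpow_add hz0]; congr 1; ring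

lemma le_growth {E : Type*} [Norm E] {f : E → ℂ} {V : Set E} {d c : ℝ} (hc : 0 < c)
    (h : ∀ R : ℝ, ∃ z ∈ V, R ≤ ‖z‖ ∧ c * ‖z‖ ^ d ≤ ‖f z‖) : (d : EReal) ≤ growthExp f V := by
  refine EReal.ge_of_forall_gt_iff_ge.1 fun s hs => ?_
  have hs' : s < d := by exact_mod_cast hs
  refine Filter.le_limsup_of_frequently_le (freq_atInftyOn fun R => ?_) (by isBoundedDefault)
  have ht := tendsto_rpow_atTop (show 0 < d - s by linarith)
  obtain ⟨R', hR'⟩ := Filter.eventually_atTop.1 (ht.eventually_ge_atTop c⁻¹)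
  obtain ⟨z, hz, hRz, hb⟩ := h (max (max R R') 2)
  have h1 : R ≤ ‖z‖ := ((le_max_left _ _).trans (le_max_left _ _)).trans hRz
  have h2 : (2 : ℝ) ≤ ‖z‖ := (le_max_right _ _).trans hRz
  have h3 : R' ≤ ‖z‖ := ((le_max_right _ _).trans (le_max_left _ _)).trans hRz
  have hz0 : 0 < ‖z‖ := by linarith
  refine ⟨z, hz, h1, le_logRatio f z (by linarith) s (le_trans ?_ hb)⟩
  have h4 : 1 ≤ c * ‖z‖ ^ (d - s) := by
    have := mul_le_mul_of_nonneg_left (hR' _ h3) hc.le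
    rwa [mul_inv_cancel₀ hc.ne'] at this
  calc ‖z‖ ^ s = 1 * ‖z‖ ^ s := (one_mul _).symm
    _ ≤ (c * ‖z‖ ^ (d - s)) * ‖z‖ ^ s := by gcongr
    _ = _ := by rw [mul_assoc, ← Real.rpow_add hz0]; congr 2; ring

lemma growth_le_deg {N : ℕ} (A : Set (EuclideanSpace ℂ (Fin N))) (p : MvPolynomial (Fin N) ℂ) :
    growthExp (fun y => evalAt y p) A ≤ ((p.totalDegree : ℝ) : EReal) := by
  refine growth_le (R := 1) (C := ∑ d ∈ p.support, ‖p.coeff d‖) fun z _ hz => ?_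
  rw [evalAt, MvPolynomial.eval_eq, Finset.sum_mul]
  refine (norm_sum_le _ _).trans (Finset.sum_le_sum fun d hd => ?_)
  rw [norm_mul, norm_prod]
  gcongr
  have h1 : ∀ i, ‖z i‖ ≤ ‖z‖ := fun i => PiLp.norm_apply_le z i
  calc ∏ i ∈ d.support, ‖z i ^ d i‖ ≤ ∏ i ∈ d.support, ‖z‖ ^ d i := by
        refine Finset.prod_le_prod (fun _ _ => norm_nonneg _) fun i _ => ?_
        rw [norm_pow]
        gcongr
        exact h1 i
    _ = ‖z‖ ^ (∑ i ∈ d.support, d i) := Finset.prod_pow_eq_pow_sum _ _ _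
    _ ≤ ‖z‖ ^ p.totalDegree := pow_le_pow_right₀ hz (MvPolynomial.le_totalDegree hd)
    _ = _ := (Real.rpow_natCast _ _).symm

lemma exists_coord {N : ℕ} (A : Set (EuclideanSpace ℂ (Fin N)))
    (hA : ∀ R : ℝ, ∃ z ∈ A, R < ‖z‖) :
    ∃ (j : Fin N) (C : ℝ), 0 < C ∧ ∀ R : ℝ, ∃ z ∈ A, R ≤ ‖z‖ ∧ ‖z‖ ≤ C * ‖z j‖ := by
  obtain ⟨C, hC, hb⟩ := (goodNN_base A).bd
  by_contra! hcon
  have h1 : ∀ j : Fin N, ∃ R : ℝ, ∀ z ∈ A, R ≤ ‖z‖ → 2 * C * ‖z j‖ < ‖z‖ := fun j =>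
    hcon j (2 * C) (by positivity)
  choose R hR using h1
  obtain ⟨z, hz, hRz⟩ := hA (2 * C + ∑ j, |R j|)
  have hs : 0 ≤ ∑ j, |R j| := Finset.sum_nonneg fun _ _ => abs_nonneg _
  have h2 : ∀ j, ‖z j‖ ≤ ‖z‖ / (2 * C) := by
    intro j
    rw [le_div_iff₀ (by positivity)]
    have : R j ≤ ‖z‖ := by
      have h3 := Finset.single_le_sum (f := fun j => |R j|) (fun _ _ => abs_nonneg _)
        (Finset.mem_univ j)
      have h4 := le_abs_self (R j)
      linarith
    have := hR j z hz this
    linarith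
  have h3 : ‖fun j => evalAt z (MvPolynomial.X j)‖ ≤ ‖z‖ / (2 * C) := by
    refine (pi_norm_le_iff_of_nonneg (by positivity)).2 fun j => ?_
    simpa [evalAt] using h2 j
  have h4 := hb z hz
  have h5 : C * (1 + ‖z‖ / (2 * C)) = C + ‖z‖ / 2 := by field_simp
  have h6 : ‖z‖ ≤ C + ‖z‖ / 2 := by
    rw [← h5]
    refine h4.trans ?_
    gcongr
  linarith

lemma tendsto_perturb {N : ℕ} (p : MvPolynomial (Fin N) ℂ) (j : Fin N) (M : ℝ)
    (z : EuclideanSpace ℂ (Fin N)) :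
    Tendsto (fun ε : ℝ => ENNReal.ofReal ‖evalAt z (MvPolynomial.C (((1 + ε * M : ℝ) : ℂ)⁻¹) *
      (p + MvPolynomial.C (ε : ℂ) * MvPolynomial.X j))‖) (nhdsWithin 0 (Set.Ioi 0))
      (nhds (ENNReal.ofReal ‖evalAt z p‖)) := by
  refine (ENNReal.continuous_ofReal.tendsto _).comp ?_
  have : ContinuousAt (fun ε : ℝ => ‖evalAt z (MvPolynomial.C (((1 + ε * M : ℝ) : ℂ)⁻¹) *
      (p + MvPolynomial.C (ε : ℂ) * MvPolynomial.X j))‖) 0 := by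
    simp only [evalAt, map_mul, map_add, MvPolynomial.eval_C, MvPolynomial.eval_X]
    refine ContinuousAt.norm (ContinuousAt.mul (ContinuousAt.inv₀ ?_ (by simp)) ?_)
    · fun_prop
    · fun_prop
  have h2 := this.tendsto
  simp only [evalAt, zero_mul, add_zero, Complex.ofReal_one, inv_one, Complex.ofReal_zero, map_zero,
    map_one, one_mul] at h2
  simp only [evalAt]
  exact h2.mono_left nhdsWithin_le_nhds

lemma perturb_K {N : ℕ} (K : Set (EuclideanSpace ℂ (Fin N))) (p : MvPolynomial (Fin N) ℂ)
    (hp : ∀ w ∈ K, ‖evalAt w p‖ ≤ 1) (j : Fin N) (M : ℝ) (hM : 0 < M)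
    (hMK : ∀ w ∈ K, ‖w j‖ ≤ M) (ε : ℝ) (hε : 0 < ε) :
    ∀ w ∈ K, ‖evalAt w (MvPolynomial.C (((1 + ε * M : ℝ) : ℂ)⁻¹) *
      (p + MvPolynomial.C (ε : ℂ) * MvPolynomial.X j))‖ ≤ 1 := by
  intro w hw
  have h1 := hp w hw
  simp only [evalAt, map_mul, map_add, MvPolynomial.eval_C, MvPolynomial.eval_X] at h1 ⊢
  have h0 : 0 < 1 + ε * M := by positivity
  rw [norm_mul, norm_inv, Complex.norm_real, Real.norm_of_nonneg h0.le, inv_mul_le_iff₀ h0, mul_one]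
  refine (norm_add_le _ _).trans ?_
  rw [norm_mul, Complex.norm_real, Real.norm_of_nonneg hε.le]
  have := hMK w hw
  gcongr

lemma growth_perturb {N : ℕ} (A : Set (EuclideanSpace ℂ (Fin N))) (p : MvPolynomial (Fin N) ℂ)
    (hg : growthExp (fun y => evalAt y p) A ≤ 0) (j : Fin N) (C : ℝ) (hC : 0 < C)
    (hj : ∀ R : ℝ, ∃ z ∈ A, R ≤ ‖z‖ ∧ ‖z‖ ≤ C * ‖z j‖) (a : ℝ) (ha : 0 < a)
    (ε : ℝ) (hε : 0 < ε) :
    growthExp (fun y => evalAt y (MvPolynomial.C ((a : ℂ)⁻¹) *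
      (p + MvPolynomial.C (ε : ℂ) * MvPolynomial.X j))) A = ((1 : ℝ) : EReal) := by
  obtain ⟨R0, hR0⟩ := bound_of_growth (s := 1 / 2) (lt_of_le_of_lt hg
    (by exact_mod_cast (by norm_num : (0 : ℝ) < 1 / 2)))
  have he : ∀ z : EuclideanSpace ℂ (Fin N), ‖evalAt z (MvPolynomial.C ((a : ℂ)⁻¹) *
      (p + MvPolynomial.C (ε : ℂ) * MvPolynomial.X j))‖ = a⁻¹ * ‖evalAt z p + ε * z j‖ := by
    intro z
    simp only [evalAt, map_mul, map_add, MvPolynomial.eval_C, MvPolynomial.eval_X]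
    rw [norm_mul, norm_inv, Complex.norm_real, Real.norm_of_nonneg ha.le]
  have hn : ∀ z : EuclideanSpace ℂ (Fin N), ‖(ε : ℂ) * z j‖ = ε * ‖z j‖ := by
    intro z
    rw [norm_mul, Complex.norm_real, Real.norm_of_nonneg hε.le]
  apply le_antisymm
  · refine growth_le (R := max R0 1) (C := a⁻¹ * (1 + ε)) fun z hz hRz => ?_
    simp only [he]
    have h1 := hR0 z hz ((le_max_left _ _).trans hRz)
    have h2 : 1 ≤ ‖z‖ := (le_max_right _ _).trans hRz
    have h3 : ‖z‖ ^ (1 / 2 : ℝ) ≤ ‖z‖ := by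
      calc _ ≤ ‖z‖ ^ (1 : ℝ) := Real.rpow_le_rpow_of_exponent_le h2 (by norm_num)
        _ = _ := Real.rpow_one _
    rw [Real.rpow_one, mul_assoc]
    gcongr
    refine (norm_add_le _ _).trans ?_
    rw [hn]
    have h4 : ‖z j‖ ≤ ‖z‖ := PiLp.norm_apply_le z j
    have h5 : ε * ‖z j‖ ≤ ε * ‖z‖ := by gcongr
    linarith
  · refine le_growth (c := a⁻¹ * (ε / (2 * C))) (by positivity) fun R => ?_
    obtain ⟨z, hz, hRz, hzj⟩ := hj (max (max R R0) (max 1 ((2 * C / ε) ^ 2)))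
    have g1 : R ≤ ‖z‖ := ((le_max_left _ _).trans (le_max_left _ _)).trans hRz
    have g2 : R0 ≤ ‖z‖ := ((le_max_right _ _).trans (le_max_left _ _)).trans hRz
    have g3 : (2 * C / ε) ^ 2 ≤ ‖z‖ := ((le_max_right _ _).trans (le_max_right _ _)).trans hRz
    refine ⟨z, hz, g1, ?_⟩
    simp only [he]
    rw [Real.rpow_one, mul_assoc]
    gcongr
    have h1 := hR0 z hz g2
    rw [← Real.sqrt_eq_rpow] at h1
    have h2 : 2 * C / ε ≤ Real.sqrt ‖z‖ := Real.le_sqrt_of_sq_le g3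
    have h3 : Real.sqrt ‖z‖ ≤ ε / (2 * C) * ‖z‖ := by
      have hs := Real.sqrt_nonneg ‖z‖
      have hm := Real.mul_self_sqrt (norm_nonneg z)
      have : 1 ≤ ε / (2 * C) * Real.sqrt ‖z‖ := by
        rw [div_le_iff₀ hε] at h2
        rw [div_mul_eq_mul_div, le_div_iff₀ (by positivity)]
        linarith
      calc Real.sqrt ‖z‖ = 1 * Real.sqrt ‖z‖ := (one_mul _).symm
        _ ≤ (ε / (2 * C) * Real.sqrt ‖z‖) * Real.sqrt ‖z‖ := by gcongr
        _ = _ := by rw [mul_assoc, hm]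
    have h4 : ε * ‖z j‖ ≤ ‖evalAt z p + ε * z j‖ + ‖evalAt z p‖ := by
      rw [← hn]
      calc _ = ‖(evalAt z p + ε * z j) - evalAt z p‖ := by congr 1; ring
        _ ≤ _ := norm_sub_le _ _
    have h5 : 2 * (ε / (2 * C) * ‖z‖) ≤ ε * ‖z j‖ := by
      have : 2 * (ε / (2 * C) * ‖z‖) = ε * (‖z‖ / C) := by field_simp
      rw [this]
      gcongr
      rw [div_le_iff₀ hC]; linarith
    linarith

lemma coord_bound {N : ℕ} (K : Set (EuclideanSpace ℂ (Fin N))) (hK : IsCompact K) (j : Fin N) :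
    ∃ M : ℝ, 0 < M ∧ ∀ w ∈ K, ‖w j‖ ≤ M := by
  obtain ⟨M, hM⟩ := hK.isBounded.exists_norm_le
  exact ⟨max M 1, by positivity, fun w hw =>
    ((PiLp.norm_apply_le w j).trans (hM w hw)).trans (le_max_left _ _)⟩

lemma phiOn_of_small {N : ℕ} (A K : Set (EuclideanSpace ℂ (Fin N)))
    (hA : ∀ R : ℝ, ∃ z ∈ A, R < ‖z‖) (hK : IsCompact K)
    (p : MvPolynomial (Fin N) ℂ) (hp : ∀ w ∈ K, ‖evalAt w p‖ ≤ 1)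
    (hg : growthExp (fun y => evalAt y p) A ≤ 0) (z : EuclideanSpace ℂ (Fin N)) :
    ENNReal.ofReal ‖evalAt z p‖ ≤ siciakPhiOn A K z := by
  obtain ⟨j, C, hC, hj⟩ := exists_coord A hA
  obtain ⟨M, hM, hMK⟩ := coord_bound K hK j
  refine le_of_tendsto (tendsto_perturb p j M z) ?_
  filter_upwards [self_mem_nhdsWithin] with ε hε
  have hε : 0 < ε := hε
  have hgr := growth_perturb A p hg j C hC hj (1 + ε * M) (by positivity) ε hε
  refine le_sSup ⟨_, perturb_K K p hp j M hM hMK ε hε, ?_, ?_, ?_⟩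
  · rw [hgr]; exact_mod_cast one_pos
  · rw [hgr]; exact EReal.coe_lt_top _
  · rw [hgr, EReal.toReal_coe, inv_one, Real.rpow_one]

lemma one_le_phiOn {N : ℕ} (A K : Set (EuclideanSpace ℂ (Fin N)))
    (hA : ∀ R : ℝ, ∃ z ∈ A, R < ‖z‖) (hK : IsCompact K) (z : EuclideanSpace ℂ (Fin N)) :
    1 ≤ siciakPhiOn A K z := by
  have h := phiOn_of_small A K hA hK 1 (by simp [evalAt])
    ((growth_le_deg A 1).trans (by simp)) z
  simpa [evalAt] using h

lemma one_le_phi {N : ℕ} (A K : Set (EuclideanSpace ℂ (Fin N)))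
    (hA : ∀ R : ℝ, ∃ z ∈ A, R < ‖z‖) (hK : IsCompact K) (z : EuclideanSpace ℂ (Fin N)) :
    1 ≤ siciakPhi K z := by
  obtain ⟨j, C, hC, hj⟩ := exists_coord A hA
  obtain ⟨M, hM, hMK⟩ := coord_bound K hK j
  have ht := tendsto_perturb 1 j M z
  have h1 : ENNReal.ofReal ‖evalAt z (1 : MvPolynomial (Fin N) ℂ)‖ = 1 := by simp [evalAt]
  rw [h1] at ht
  refine le_of_tendsto ht ?_
  filter_upwards [self_mem_nhdsWithin] with ε hε
  have hε : 0 < ε := hε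
  have hd : (MvPolynomial.C (((1 + ε * M : ℝ) : ℂ)⁻¹) *
      ((1 : MvPolynomial (Fin N) ℂ) + MvPolynomial.C (ε : ℂ) * MvPolynomial.X j)).totalDegree
      = 1 := by
    have hX : (MvPolynomial.C (ε : ℂ) * MvPolynomial.X j :
        MvPolynomial (Fin N) ℂ).totalDegree = 1 := by
      rw [MvPolynomial.totalDegree_mul_of_isDomain, MvPolynomial.totalDegree_C,
        MvPolynomial.totalDegree_X]
      · simpa using hε.ne'
      · exact MvPolynomial.X_ne_zero j
    have hs : ((1 : MvPolynomial (Fin N) ℂ) +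
        MvPolynomial.C (ε : ℂ) * MvPolynomial.X j).totalDegree = 1 := by
      rw [MvPolynomial.totalDegree_add_eq_right_of_totalDegree_lt, hX]
      rw [hX, MvPolynomial.totalDegree_one]; exact one_pos
    rw [MvPolynomial.totalDegree_mul_of_isDomain, MvPolynomial.totalDegree_C, hs]
    · have : 0 < 1 + ε * M := by positivity
      rw [Ne, MvPolynomial.C_eq_zero, inv_eq_zero]
      exact_mod_cast this.ne'
    · intro h0
      rw [h0, MvPolynomial.totalDegree_zero] at hs
      exact zero_ne_one hs
  refine le_sSup ⟨_, hd.ge, perturb_K K 1 (by simp [evalAt]) j M hM hMK ε hε, ?_⟩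
  rw [hd, Nat.cast_one, inv_one, Real.rpow_one]

lemma phi_le {N : ℕ} (A K : Set (EuclideanSpace ℂ (Fin N)))
    (hA : ∀ R : ℝ, ∃ z ∈ A, R < ‖z‖) (hK : IsCompact K) (z : EuclideanSpace ℂ (Fin N)) :
    siciakPhi K z ≤ siciakPhiOn A K z := by
  refine sSup_le ?_
  rintro x ⟨p, hd, hp, rfl⟩
  have hd' : (1 : ℝ) ≤ p.totalDegree := by exact_mod_cast hd
  rcases le_or_gt ‖evalAt z p‖ 1 with h1 | h1
  · refine le_trans ?_ (one_le_phiOn A K hA hK z)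
    rw [ENNReal.ofReal_le_one]
    exact Real.rpow_le_one (norm_nonneg _) h1 (by positivity)
  rcases le_or_gt (growthExp (fun y => evalAt y p) A) 0 with h2 | h2
  · refine le_trans (ENNReal.ofReal_le_ofReal ?_) (phiOn_of_small A K hA hK p hp h2 z)
    calc _ ≤ ‖evalAt z p‖ ^ (1 : ℝ) :=
          Real.rpow_le_rpow_of_exponent_le h1.le (inv_le_one_of_one_le₀ hd')
      _ = _ := Real.rpow_one _
  · have h3 := growth_le_deg A p
    have h4 : growthExp (fun y => evalAt y p) A < ⊤ := h3.trans_lt (EReal.coe_lt_top _)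
    have h5 : growthExp (fun y => evalAt y p) A ≠ ⊥ := (bot_lt_of_lt h2).ne'
    have h6 := EReal.coe_toReal h4.ne h5
    refine le_trans (ENNReal.ofReal_le_ofReal ?_) (le_sSup ⟨p, hp, h2, h4, rfl⟩)
    refine Real.rpow_le_rpow_of_exponent_le h1.le ?_
    rw [← h6] at h2 h3
    have h2 : 0 < (growthExp (fun y => evalAt y p) A).toReal := by exact_mod_cast h2
    have h3 := EReal.coe_le_coe_iff.1 h3
    exact inv_anti₀ h2 h3

lemma global_bound {N : ℕ} (A : Set (EuclideanSpace ℂ (Fin N))) (p : MvPolynomial (Fin N) ℂ)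
    (s : ℝ) (hs : 0 ≤ s) (h : growthExp (fun y => evalAt y p) A < (s : EReal)) :
    ∃ C : ℝ, ∀ z ∈ A, ‖evalAt z p‖ ≤ C * (1 + ‖z‖) ^ s := by
  obtain ⟨R, hR⟩ := bound_of_growth h
  obtain ⟨M, hM, hb⟩ := bounded_ball p R
  refine ⟨max M 1, fun z hz => ?_⟩
  have h0 := norm_nonneg z
  rcases le_total ‖z‖ R with h1 | h1
  · calc _ ≤ M := hb z h1
      _ ≤ max M 1 * 1 := by rw [mul_one]; exact le_max_left _ _
      _ ≤ _ := by
        gcongr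
        exact Real.one_le_rpow (by linarith) hs
  · calc _ ≤ ‖z‖ ^ s := hR z hz h1
      _ ≤ (1 + ‖z‖) ^ s := Real.rpow_le_rpow h0 (by linarith) hs
      _ = 1 * (1 + ‖z‖) ^ s := (one_mul _).symm
      _ ≤ _ := by
        gcongr
        exact le_max_right _ _

lemma tendsto_ratio (ρ C0 : ℝ) (hρ : 0 < ρ) :
    Tendsto (fun k : ℕ => (k : ℝ) / (k * ρ + C0)) atTop (nhds ρ⁻¹) := by
  have h1 : Tendsto (fun k : ℕ => (ρ + C0 / k)⁻¹) atTop (nhds ρ⁻¹) := by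
    have h := (tendsto_const_div_atTop_nhds_zero_nat C0).const_add ρ
    rw [add_zero] at h
    exact h.inv₀ hρ.ne'
  refine h1.congr' ?_
  filter_upwards [eventually_gt_atTop 0] with k hk
  have hk : (0 : ℝ) < k := by exact_mod_cast hk
  have : (k : ℝ) * ρ + C0 = k * (ρ + C0 / k) := by field_simp
  rw [this, ← div_div, div_self hk.ne', one_div]

lemma phiOn_le {N : ℕ} (A : Set (EuclideanSpace ℂ (Fin N)))
    (halg : IsAlgebraicSet A) (hprime : (vanishIdeal A).IsPrime)
    (hA : ∀ R : ℝ, ∃ z ∈ A, R < ‖z‖)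
    (K : Set (EuclideanSpace ℂ (Fin N))) (hKA : K ⊆ A) (hKne : K.Nonempty)
    (hK : IsCompact K) (z : EuclideanSpace ℂ (Fin N)) (hz : z ∈ A) :
    siciakPhiOn A K z ≤ siciakPhi K z := by
  refine sSup_le ?_
  rintro x ⟨p, hp, hpos, htop, rfl⟩
  have h6 := EReal.coe_toReal htop.ne (bot_lt_of_lt hpos).ne'
  set ρ := (growthExp (fun y => evalAt y p) A).toReal with hρdef
  have hρ : 0 < ρ := by rw [← h6] at hpos; exact_mod_cast hpos
  rcases le_or_gt ‖evalAt z p‖ 1 with h1 | h1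
  · refine le_trans ?_ (one_le_phi A K hA hK z)
    rw [ENNReal.ofReal_le_one]
    exact Real.rpow_le_one (norm_nonneg _) h1 (by positivity)
  obtain ⟨C0, hC0, hP⟩ := key_powers A halg hprime p ρ hρ.le (fun s hs =>
    global_bound A p s (hρ.le.trans hs.le) (by rw [← h6]; exact_mod_cast hs))
  have ht : Tendsto (fun k : ℕ => ENNReal.ofReal (‖evalAt z p‖ ^ ((k : ℝ) / (k * ρ + C0)))) atTop
      (nhds (ENNReal.ofReal (‖evalAt z p‖ ^ ρ⁻¹))) :=
    (ENNReal.continuous_ofReal.tendsto _).comp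
      (((Real.continuous_const_rpow (zero_lt_one.trans h1).ne').tendsto _).comp
        (tendsto_ratio ρ C0 hρ))
  refine le_of_tendsto ht ?_
  filter_upwards [eventually_gt_atTop 0] with k hk
  obtain ⟨P, hPe, hPd⟩ := hP k
  have hPK : ∀ w ∈ K, ‖evalAt w P‖ ≤ 1 := by
    intro w hw
    rw [hPe w (hKA hw), norm_pow]
    exact pow_le_one₀ (norm_nonneg _) (hp w hw)
  have hPz : ‖evalAt z P‖ = ‖evalAt z p‖ ^ k := by rw [hPe z hz, norm_pow]
  have hPz1 : 1 < ‖evalAt z P‖ := by rw [hPz]; exact one_lt_pow₀ h1 hk.ne'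
  have hdeg : 1 ≤ P.totalDegree := by
    by_contra hcon
    have h0 : P.totalDegree = 0 := by omega
    rw [MvPolynomial.totalDegree_eq_zero_iff_eq_C] at h0
    obtain ⟨w, hw⟩ := hKne
    have h2 := hPK w hw
    rw [h0] at h2 hPz1
    simp only [evalAt, MvPolynomial.eval_C] at h2 hPz1
    linarith
  refine le_trans (ENNReal.ofReal_le_ofReal ?_) (le_sSup ⟨P, hdeg, hPK, rfl⟩)
  have hd' : (0 : ℝ) < P.totalDegree := by exact_mod_cast hdeg
  rw [hPz, ← Real.rpow_natCast, ← Real.rpow_mul (norm_nonneg _)]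
  refine Real.rpow_le_rpow_of_exponent_le h1.le ?_
  rw [div_eq_mul_inv]
  gcongr

/-- For an irreducible algebraic set `𝒜 ⊆ ℂᴺ` of positive dimension
(equivalently, infinite) and a nonempty compact set `K ⊆ 𝒜`, the classical Siciak extremal
function `Φ_K` and the Siciak extremal function `Φ_{K,𝒜}` of `K` on `𝒜` coincide at every
point of `𝒜`. -/
theorem statement10 {N : ℕ} (A : Set (EuclideanSpace ℂ (Fin N)))
    (halg : IsAlgebraicSet A) (hprime : (vanishIdeal A).IsPrime) (hinf : A.Infinite)
    (K : Set (EuclideanSpace ℂ (Fin N))) (hKA : K ⊆ A) (hKne : K.Nonempty)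
    (hK : IsCompact K) :
    ∀ z ∈ A, siciakPhi K z = siciakPhiOn A K z := by
  intro z hz
  have hA : ∀ R : ℝ, ∃ z ∈ A, R < ‖z‖ := A_unbounded A halg hprime hinf
  exact le_antisymm (phi_le A K hA hK z) (phiOn_le A halg hprime hA K hKA hKne hK z hz)
end

section
/- (Bernstein–Walsh inequality on algebraic sets.) Let 𝒜 ⊆ ℂ^N be an irreducible algebraic set of positive dimension (equivalently, infinite), let K ⊆ 𝒜 be a nonempty compact set, and let p ∈ ℂ[z₁,…,z_N] satisfy sup_K |p| ≤ 1 and 0 < ρ(p,𝒜) < ∞, where ρ(p,𝒜) := limsup_{𝒜∋z→∞} log|p(z)|/log‖z‖. Then for every z ∈ 𝒜: log|p(z)| ≤ ρ(p,𝒜) · V_K(z). -/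
open Filter MvPolynomial Metric Set ENNReal

namespace BW

/-- The substitution hom for the Rees-type algebra. -/
noncomputable def th {k R : Type*} [Field k] [CommRing R] [Algebra k R] {n : ℕ} (x : Fin n → R) :
    MvPolynomial (Option (Fin n)) k →ₐ[k] Polynomial R :=
  MvPolynomial.aeval (fun o : Option (Fin n) =>
    o.elim (Polynomial.X) (fun i => Polynomial.C (x i) * Polynomial.X))

lemma eval_top {k : Type*} [Field k] {n : ℕ} (F : MvPolynomial (Fin n) k) (c : Fin n → k) :
    MvPolynomial.eval c (MvPolynomial.homogeneousComponent F.totalDegree F) =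
      ∑ m ∈ F.support, if m.degree = F.totalDegree then F.coeff m * ∏ i, c i ^ m i else 0 := by
  rw [MvPolynomial.homogeneousComponent_apply, map_sum, Finset.sum_filter]
  apply Finset.sum_congr rfl
  intro m _
  split_ifs
  · rw [MvPolynomial.eval_monomial, Finsupp.prod_fintype _ _ (by simp)]
  · rfl

lemma degree_le {k : Type*} [Field k] {n : ℕ} (F : MvPolynomial (Fin n) k) {m : Fin n →₀ ℕ}
    (hm : m ∈ F.support) : m.degree ≤ F.totalDegree := by
  have := MvPolynomial.le_totalDegree hm
  exact this

lemma top_ne_zero {k : Type*} [Field k] {n : ℕ} (F : MvPolynomial (Fin n) k) (hF : F ≠ 0) :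
    MvPolynomial.homogeneousComponent F.totalDegree F ≠ 0 := by
  obtain ⟨m, hm, h⟩ := Finset.exists_mem_eq_sup F.support (by simpa using hF)
    (fun s : Fin n →₀ ℕ => s.sum fun _ e => e)
  intro h0
  have h1 := MvPolynomial.coeff_homogeneousComponent F.totalDegree F m
  rw [h0, if_pos] at h1
  · exact (MvPolynomial.mem_support_iff.mp hm) (by simpa using h1.symm)
  · rw [MvPolynomial.totalDegree, h]; rfl

lemma exists_top {k : Type*} [Field k] [Infinite k] {n : ℕ} (F : MvPolynomial (Fin n) k)
    (hF : F ≠ 0) :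
    ∃ c, MvPolynomial.eval c (MvPolynomial.homogeneousComponent F.totalDegree F) ≠ 0 := by
  by_contra! h
  exact top_ne_zero F hF (MvPolynomial.funext (fun x => by simpa using h x))

lemma prod_lin {S : Type*} [CommRing S] {n : ℕ} (w c : Fin n → S) (m : Fin n →₀ ℕ) :
    (∏ i, (Polynomial.C (w i) + Polynomial.C (c i) * Polynomial.X) ^ m i).natDegree ≤ m.degree ∧
    (∏ i, (Polynomial.C (w i) + Polynomial.C (c i) * Polynomial.X) ^ m i).coeff m.degree =
      ∏ i, c i ^ m i := by
  have key : ∀ s : Finset (Fin n),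
      (∏ i ∈ s, (Polynomial.C (w i) + Polynomial.C (c i) * Polynomial.X) ^ m i).natDegree
        ≤ ∑ i ∈ s, m i ∧
      (∏ i ∈ s, (Polynomial.C (w i) + Polynomial.C (c i) * Polynomial.X) ^ m i).coeff
        (∑ i ∈ s, m i) = ∏ i ∈ s, c i ^ m i := by
    intro s
    induction s using Finset.induction_on with
    | empty => simp
    | insert a s ha ih =>
      rw [Finset.prod_insert ha, Finset.sum_insert ha, Finset.prod_insert ha]
      have h1 : (Polynomial.C (w a) + Polynomial.C (c a) * Polynomial.X).natDegree ≤ 1 := by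
        compute_degree
      have h2 : ((Polynomial.C (w a) + Polynomial.C (c a) * Polynomial.X) ^ m a).natDegree
          ≤ m a := by
        simpa using Polynomial.natDegree_pow_le_of_le (m a) h1
      refine ⟨Polynomial.natDegree_mul_le_of_le h2 ih.1, ?_⟩
      rw [Polynomial.coeff_mul_add_eq_of_natDegree_le h2 ih.1, ih.2]
      have := Polynomial.coeff_pow_of_natDegree_le (m := m a) h1
      rw [mul_one] at this
      rw [this]; simp [Polynomial.coeff_C]
  have := key Finset.univ
  rwa [← Finsupp.degree_eq_sum] at this

lemma step {k R : Type*} [Field k] [Infinite k] [CommRing R] [Nontrivial R] [Algebra k R] {n : ℕ}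
    (x : Fin (n+1) → R) (hx : ¬ AlgebraicIndependent k x) :
    ∃ x' : Fin n → R, (∀ j, x' j ∈ Submodule.span k (Set.range x)) ∧
      ∀ i, (th (k := k) x').toRingHom.IsIntegralElem (Polynomial.C (x i) * Polynomial.X) := by
  rw [algebraicIndependent_iff] at hx
  push Not at hx
  obtain ⟨F, hF0, hF⟩ := hx
  obtain ⟨c, hc⟩ := exists_top F hF
  have hd : F.totalDegree ≠ 0 := by
    intro h0
    rw [MvPolynomial.totalDegree_eq_zero_iff_eq_C] at h0
    rw [h0] at hF0 hF
    simp at hF0 hF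
    exact hF hF0
  have hck : ∃ k', c k' ≠ 0 := by
    by_contra! h
    apply hc
    rw [eval_top]
    apply Finset.sum_eq_zero
    intro m hm
    split_ifs with hmd
    · have : ∃ i, m i ≠ 0 := by
        by_contra! h'
        apply hd
        rw [← hmd]
        have : m = 0 := by ext i; simp [h']
        simp [this]
      obtain ⟨i, hi⟩ := this
      rw [Finset.prod_eq_zero (Finset.mem_univ i), mul_zero]
      simp [h, hi]
    · rfl
  obtain ⟨l, hl⟩ := hck
  set d := F.totalDegree with hd'
  let x' : Fin n → R := fun j => x (l.succAbove j) - (c (l.succAbove j) / c l) • x l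
  let y : R := (c l)⁻¹ • x l
  let w : Fin (n+1) → MvPolynomial (Option (Fin n)) k :=
    l.insertNth 0 (fun j => MvPolynomial.X (some j))
  have hw : ∀ i, th x' (w i) = Polynomial.C (x i - c i • y) * Polynomial.X := by
    intro i
    induction i using l.succAboveCases with
    | x => simp [w, y, hl]
    | p j => simp [w, th, x', y, smul_smul, div_eq_mul_inv]
  let G : Polynomial (MvPolynomial (Option (Fin n)) k) :=
    ∑ m ∈ F.support, Polynomial.C (MvPolynomial.C (F.coeff m) *
      MvPolynomial.X none ^ (d - m.degree)) *
      ∏ i, (Polynomial.C (w i) + Polynomial.C (MvPolynomial.C (c i)) * Polynomial.X) ^ m i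
  have hGd : G.natDegree ≤ d := by
    apply Polynomial.natDegree_sum_le_of_forall_le
    intro m hm
    refine (Polynomial.natDegree_C_mul_le _ _).trans ?_
    exact (prod_lin w (fun i => MvPolynomial.C (c i)) m).1.trans (degree_le F hm)
  have hGc : G.coeff d = MvPolynomial.C (MvPolynomial.eval c
      (MvPolynomial.homogeneousComponent d F)) := by
    rw [hd', eval_top, Polynomial.finsetSum_coeff, map_sum]
    apply Finset.sum_congr rfl
    intro m hm
    rw [Polynomial.coeff_C_mul]
    split_ifs with h
    · rw [← hd', ← hd'] at *
      rw [← h, (prod_lin w (fun i => MvPolynomial.C (c i)) m).2]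
      simp
    · rw [Polynomial.coeff_eq_zero_of_natDegree_lt, mul_zero, map_zero]
      exact (prod_lin w (fun i => MvPolynomial.C (c i)) m).1.trans_lt
        (lt_of_le_of_ne (degree_le F hm) h)
  have hintegral : (th (k := k) x').toRingHom.IsIntegralElem (Polynomial.C y * Polynomial.X) := by
    set e := MvPolynomial.eval c (MvPolynomial.homogeneousComponent d F) with he
    refine ⟨Polynomial.C (MvPolynomial.C e⁻¹) * G, ?_, ?_⟩
    · apply Polynomial.monic_of_natDegree_le_of_coeff_eq_one d
      · exact (Polynomial.natDegree_C_mul_le _ _).trans hGd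
      · rw [Polynomial.coeff_C_mul, hGc, ← map_mul, inv_mul_cancel₀ hc, map_one]
    · rw [Polynomial.eval₂_mul]
      convert mul_zero _
      simp only [G]
      rw [Polynomial.eval₂_finsetSum]
      have hterm : ∀ m ∈ F.support, Polynomial.eval₂ (th (k := k) x').toRingHom
          (Polynomial.C y * Polynomial.X) (Polynomial.C (MvPolynomial.C (F.coeff m) *
          MvPolynomial.X none ^ (d - m.degree)) *
          ∏ i, (Polynomial.C (w i) + Polynomial.C (MvPolynomial.C (c i)) * Polynomial.X) ^ m i)
          = Polynomial.C (algebraMap k R (F.coeff m) * ∏ i, x i ^ m i) * Polynomial.X ^ d := by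
        intro m hm
        rw [Polynomial.eval₂_mul, Polynomial.eval₂_finsetProd]
        have h1 : ∀ i, Polynomial.eval₂ (th (k := k) x').toRingHom
          (Polynomial.C y * Polynomial.X)
          ((Polynomial.C (w i) + Polynomial.C (MvPolynomial.C (c i)) * Polynomial.X) ^ m i)
          = Polynomial.C (x i ^ m i) * Polynomial.X ^ m i := by
          intro i
          rw [Polynomial.eval₂_pow, Polynomial.eval₂_add, Polynomial.eval₂_mul]
          simp only [Polynomial.eval₂_C, Polynomial.eval₂_X, AlgHom.toRingHom_eq_coe,
            RingHom.coe_coe, hw]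
          have : th (k := k) x' (MvPolynomial.C (c i)) = Polynomial.C (algebraMap k R (c i)) := by
            simp [th, Polynomial.algebraMap_apply]
          rw [this, map_pow, ← mul_pow]
          congr 1
          rw [Algebra.smul_def]
          simp only [map_sub, map_mul]
          ring
        simp_rw [h1]
        rw [Finset.prod_mul_distrib, Finset.prod_pow_eq_pow_sum, ← Finsupp.degree_eq_sum]
        simp only [Polynomial.eval₂_C, AlgHom.toRingHom_eq_coe,
            RingHom.coe_coe]
        have : th (k := k) x' (MvPolynomial.C (F.coeff m) *
          MvPolynomial.X none ^ (d - m.degree)) = Polynomial.C (algebraMap k R (F.coeff m)) *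
            Polynomial.X ^ (d - m.degree) := by
          simp [th, Polynomial.algebraMap_apply]
        rw [this]
        have hdd : Polynomial.X ^ d = (Polynomial.X : Polynomial R) ^ (d - m.degree) *
          Polynomial.X ^ m.degree := by
          rw [← pow_add, Nat.sub_add_cancel (degree_le F hm)]
        rw [hdd, map_mul, map_prod]
        ring
      rw [Finset.sum_congr rfl hterm, ← Finset.sum_mul, ← map_sum]
      rw [MvPolynomial.aeval_def, MvPolynomial.eval₂_eq'] at hF0
      rw [hF0]; simp
  refine ⟨x', ?_, ?_⟩
  · intro j
    exact Submodule.sub_mem _ (Submodule.subset_span ⟨_, rfl⟩)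
      (Submodule.smul_mem _ _ (Submodule.subset_span ⟨_, rfl⟩))
  · intro i
    let _ := (th (k := k) x').toRingHom.toAlgebra
    have h1 : IsIntegral (MvPolynomial (Option (Fin n)) k) (th (k := k) x' (w i)) :=
      isIntegral_algebraMap
    have h2 : IsIntegral (MvPolynomial (Option (Fin n)) k)
        (th (k := k) x' (MvPolynomial.C (c i))) :=
      isIntegral_algebraMap
    have h3 : IsIntegral (MvPolynomial (Option (Fin n)) k) (Polynomial.C y * Polynomial.X) := hintegral
    have h4 := h1.add (h2.mul h3)
    have : th (k := k) x' (MvPolynomial.C (c i)) = Polynomial.C (algebraMap k R (c i)) := by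
            simp [th, Polynomial.algebraMap_apply]
    rw [hw, this] at h4
    have heq : Polynomial.C (x i - c i • y) * Polynomial.X +
        Polynomial.C ((algebraMap k R) (c i)) * (Polynomial.C y * Polynomial.X) =
        Polynomial.C (x i) * Polynomial.X := by
      rw [Algebra.smul_def]
      simp only [map_sub, map_mul]
      ring
    rw [heq] at h4
    exact h4

lemma trans_int {k R : Type*} [Field k] [CommRing R] [Algebra k R] {n n' : ℕ}
    (x : Fin n → R) (x' : Fin n' → R)
    (h : ∀ i, (th (k := k) x).toRingHom.IsIntegralElem (Polynomial.C (x' i) * Polynomial.X))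
    (y : Polynomial R) (hy : (th (k := k) x').toRingHom.IsIntegralElem y) :
    (th (k := k) x).toRingHom.IsIntegralElem y := by
  let _ := (th (k := k) x).toRingHom.toAlgebra
  have hX : ∀ b, IsIntegral (MvPolynomial (Option (Fin n)) k) (th (k := k) x' b) := by
    intro b
    induction b using MvPolynomial.induction_on with
    | C a =>
      have : th (k := k) x' (MvPolynomial.C a) = th (k := k) x (MvPolynomial.C a) := by
        simp [th]
      rw [this]
      exact isIntegral_algebraMap
    | add p q hp hq => rw [map_add]; exact hp.add hq
    | mul_X p i hp =>
      rw [map_mul]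
      refine hp.mul ?_
      cases i with
      | none =>
        have : th (k := k) x' (MvPolynomial.X none) = th (k := k) x (MvPolynomial.X none) := by
          simp [th]
        rw [this]
        exact isIntegral_algebraMap
      | some i =>
        have : th (k := k) x' (MvPolynomial.X (some i)) = Polynomial.C (x' i) * Polynomial.X := by
          simp [th]
        rw [this]
        exact h i
  let f : MvPolynomial (Option (Fin n')) k →+*
      integralClosure (MvPolynomial (Option (Fin n)) k) (Polynomial R) :=
    (th (k := k) x').toRingHom.codRestrict _ hX
  obtain ⟨g, hg, hgy⟩ := hy
  have : IsIntegral (integralClosure (MvPolynomial (Option (Fin n)) k) (Polynomial R)) y := by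
    refine ⟨g.map f, hg.map f, ?_⟩
    rw [Polynomial.eval₂_map]
    exact hgy
  exact isIntegral_trans (R := MvPolynomial (Option (Fin n)) k) y this

lemma noether {k R : Type*} [Field k] [Infinite k] [CommRing R] [Nontrivial R] [Algebra k R]
    (N : ℕ) (z : Fin N → R) :
    ∃ (n : ℕ) (x : Fin n → R), (∀ j, x j ∈ Submodule.span k (Set.range z)) ∧
      AlgebraicIndependent k x ∧
      ∀ i, (th (k := k) x).toRingHom.IsIntegralElem (Polynomial.C (z i) * Polynomial.X) := by
  induction N with
  | zero =>
    exact ⟨0, z, fun j => j.elim0, algebraicIndependent_empty_type, fun j => j.elim0⟩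
  | succ N ih =>
    by_cases hz : AlgebraicIndependent k z
    · refine ⟨N+1, z, fun j => Submodule.subset_span ⟨_, rfl⟩, hz, fun i => ?_⟩
      have : Polynomial.C (z i) * Polynomial.X = (th (k := k) z).toRingHom
        (MvPolynomial.X (some i)) := by simp [th]
      rw [this]
      exact RingHom.isIntegralElem_map _
    · obtain ⟨x', hx', hi⟩ := step z hz
      obtain ⟨n, x, hx, hai, hxi⟩ := ih x'
      refine ⟨n, x, fun j => ?_, hai, fun i => trans_int x x' hxi _ (hi i)⟩
      refine (Submodule.span_le.mpr ?_) (hx j)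
      rintro _ ⟨j, rfl⟩
      exact hx' j

end BW
namespace BW

lemma int_spec {k R : Type*} [Field k] [CommRing R] [Algebra k R] {n : ℕ}
    (x : Fin n → R) (y : R)
    (h : (th (k := k) x).toRingHom.IsIntegralElem (Polynomial.C y * Polynomial.X)) :
    (MvPolynomial.aeval (R := k) x).toRingHom.IsIntegralElem y := by
  obtain ⟨f, hf, hfy⟩ := h
  let σ : MvPolynomial (Option (Fin n)) k →ₐ[k] MvPolynomial (Fin n) k :=
    MvPolynomial.aeval (fun o : Option (Fin n) => o.elim 1 MvPolynomial.X)
  refine ⟨f.map σ.toRingHom, hf.map _, ?_⟩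
  rw [Polynomial.eval₂_map]
  let e : Polynomial R →ₐ[R] R := Polynomial.aeval 1
  have h1 : (MvPolynomial.aeval (R := k) x).comp σ = (e.restrictScalars k).comp (th (k := k) x) := by
    ext o
    cases o <;> simp [σ, e, th]
  have h2 : (MvPolynomial.aeval (R := k) x).toRingHom.comp σ.toRingHom =
      (e.toRingHom).comp (th (k := k) x).toRingHom := by
    exact RingHom.ext fun a => DFunLike.congr_fun h1 a
  have h3 : y = e.toRingHom (Polynomial.C y * Polynomial.X) := by simp [e]
  rw [h2]
  nth_rw 1 [h3]
  rw [← Polynomial.hom_eval₂, hfy, map_zero]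

lemma mv_bdd {σ : Type*} (b : MvPolynomial σ ℂ) :
    ∃ M : ℝ, 0 ≤ M ∧ ∀ v : σ → ℂ, (∀ i, ‖v i‖ ≤ 1) → ‖MvPolynomial.eval v b‖ ≤ M := by
  induction b using MvPolynomial.induction_on with
  | C a => exact ⟨‖a‖, norm_nonneg _, fun v _ => by simp⟩
  | add p q hp hq =>
    obtain ⟨M, hM0, hM⟩ := hp
    obtain ⟨M', hM0', hM'⟩ := hq
    refine ⟨M + M', by positivity, fun v hv => ?_⟩
    rw [map_add]
    exact (norm_add_le _ _).trans (add_le_add (hM v hv) (hM' v hv))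
  | mul_X p i hp =>
    obtain ⟨M, hM0, hM⟩ := hp
    refine ⟨M, hM0, fun v hv => ?_⟩
    rw [map_mul, norm_mul, MvPolynomial.eval_X]
    calc _ ≤ M * 1 := mul_le_mul (hM v hv) (hv i) (norm_nonneg _) hM0
      _ = M := mul_one _

lemma root_bound (f : Polynomial ℂ) (hf : f.Monic) (r : ℂ) (hr : f.eval r = 0) :
    ‖r‖ ≤ 1 + ∑ i ∈ Finset.range f.natDegree, ‖f.coeff i‖ := by
  by_contra! hcon
  have hS : 0 ≤ ∑ i ∈ Finset.range f.natDegree, ‖f.coeff i‖ :=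
    Finset.sum_nonneg (fun _ _ => norm_nonneg _)
  have h1 : 1 < ‖r‖ := by linarith
  rw [Polynomial.eval_eq_sum_range, Finset.sum_range_succ, hf.coeff_natDegree, one_mul] at hr
  set d := f.natDegree
  rcases Nat.eq_zero_or_pos d with h0 | h0
  · simp [h0] at hr
  have h2 : ‖r‖ ^ d ≤ (∑ i ∈ Finset.range d, ‖f.coeff i‖) * ‖r‖ ^ (d - 1) := by
    have : r ^ d = - ∑ i ∈ Finset.range d, f.coeff i * r ^ i := by linear_combination hr
    rw [← norm_pow, this, norm_neg, Finset.sum_mul]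
    refine (norm_sum_le _ _).trans (Finset.sum_le_sum fun i hi => ?_)
    rw [norm_mul, norm_pow]
    refine mul_le_mul_of_nonneg_left ?_ (norm_nonneg _)
    exact pow_le_pow_right₀ h1.le (by have := Finset.mem_range.mp hi; omega)
  have h3 : ‖r‖ ^ d = ‖r‖ * ‖r‖ ^ (d - 1) := by
    rw [← pow_succ', Nat.sub_add_cancel h0]
  rw [h3] at h2
  have h4 : 0 < ‖r‖ ^ (d - 1) := by positivity
  have := le_of_mul_le_mul_right h2 h4
  linarith

lemma lin_bound {R : Type*} [CommRing R] [Algebra ℂ R] {n : ℕ}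
    (x : Fin n → R) (y : R)
    (h : (th (k := ℂ) x).toRingHom.IsIntegralElem (Polynomial.C y * Polynomial.X)) :
    ∃ M : ℝ, 0 ≤ M ∧ ∀ φ : R →ₐ[ℂ] ℂ, ‖φ y‖ ≤ M * (1 + ‖fun j => φ (x j)‖) := by
  obtain ⟨f, hf, hfy⟩ := h
  choose M hM0 hM using fun i => mv_bdd (f.coeff i)
  refine ⟨1 + ∑ i ∈ Finset.range f.natDegree, M i,
    add_nonneg zero_le_one (Finset.sum_nonneg fun i _ => hM0 i), fun φ => ?_⟩
  set B : ℝ := 1 + ‖fun j => φ (x j)‖ with hB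
  have hB1 : 1 ≤ B := by rw [hB]; linarith [norm_nonneg (fun j => φ (x j))]
  have hB0 : 0 < B := by linarith
  let t : ℂ := ((B⁻¹ : ℝ) : ℂ)
  have ht : ‖t‖ = B⁻¹ := by
    simp only [t]
    rw [Complex.norm_real, Real.norm_of_nonneg (by positivity)]
  let v : Option (Fin n) → ℂ := fun o => o.elim t (fun i => φ (x i) * t)
  have hv : ∀ o, ‖v o‖ ≤ 1 := by
    intro o
    cases o with
    | none => simp only [v, Option.elim]; rw [ht]; exact inv_le_one_of_one_le₀ hB1
    | some i =>
      simp only [v, Option.elim]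
      rw [norm_mul, ht, ← div_eq_mul_inv, div_le_one hB0, hB]
      linarith [norm_le_pi_norm (fun j => φ (x j)) i]
  let e : Polynomial R →+* ℂ := Polynomial.eval₂RingHom φ.toRingHom t
  have h2 : e.comp (th (k := ℂ) x).toRingHom = MvPolynomial.eval v := by
    apply MvPolynomial.ringHom_ext
    · intro a
      simp [e, th, Polynomial.algebraMap_apply]
    · intro o
      cases o <;> simp [e, th, v]
  have h3 : Polynomial.eval (φ y * t) (f.map (MvPolynomial.eval v)) = 0 := by
    rw [Polynomial.eval_map, ← h2]
    have : φ y * t = e (Polynomial.C y * Polynomial.X) := by simp [e]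
    rw [this, ← Polynomial.hom_eval₂, hfy, map_zero]
  have h4 := root_bound _ (hf.map _) _ h3
  rw [hf.natDegree_map, norm_mul, ht, ← div_eq_mul_inv, div_le_iff₀ hB0] at h4
  refine h4.trans (mul_le_mul_of_nonneg_right ?_ hB0.le)
  gcongr with i hi
  rw [Polynomial.coeff_map]
  exact hM i v hv

lemma deg_le_of_growth {n : ℕ} (q : MvPolynomial (Fin n) ℂ) (M : ℝ) (s : ℕ)
    (h : ∀ x : Fin n → ℂ, ‖MvPolynomial.eval x q‖ ≤ M * (1 + ‖x‖) ^ s) : q.totalDegree ≤ s := by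
  by_contra! hlt
  have hq : q ≠ 0 := by rintro rfl; simp at hlt
  obtain ⟨c, hc⟩ := exists_top q hq
  set d := q.totalDegree with hd
  let r : ℝ → ℂ := fun t => ∑ m ∈ q.support, q.coeff m * (t : ℂ) ^ (d - m.degree) * ∏ i, c i ^ m i
  have hr0 : r 0 = MvPolynomial.eval c (MvPolynomial.homogeneousComponent d q) := by
    rw [hd, eval_top]
    apply Finset.sum_congr rfl
    intro m hm
    split_ifs with h
    · simp [h, hd]
    · have : d - m.degree ≠ 0 := by have := degree_le q hm; omega
      simp [this]
  have hrc : Continuous r := by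
    simp only [r]; fun_prop
  have hre : ∀ t : ℝ, 0 < t → r t = (t : ℂ) ^ d * MvPolynomial.eval (fun i => c i / t) q := by
    intro t ht
    have ht' : (t : ℂ) ≠ 0 := by exact_mod_cast ht.ne'
    rw [MvPolynomial.eval_eq', Finset.mul_sum]
    apply Finset.sum_congr rfl
    intro m hm
    simp_rw [div_pow]
    rw [Finset.prod_div_distrib, Finset.prod_pow_eq_pow_sum, ← Finsupp.degree_eq_sum]
    have : (t : ℂ) ^ d = (t : ℂ) ^ (d - m.degree) * (t : ℂ) ^ m.degree := by
      rw [← pow_add, Nat.sub_add_cancel (degree_le q hm)]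
    rw [this]
    field_simp
  have hb : ∀ t : ℝ, 0 < t → ‖r t‖ ≤ t ^ (d - s) * (M * (t + ‖c‖) ^ s) := by
    intro t ht
    rw [hre t ht, norm_mul, norm_pow, Complex.norm_real, Real.norm_of_nonneg ht.le]
    have h1 := h (fun i => c i / t)
    have h2 : ‖fun i => c i / (t : ℂ)‖ = ‖c‖ / t := by
      have : (fun i => c i / (t : ℂ)) = ((t : ℂ)⁻¹) • c := by
        ext i; simp [div_eq_inv_mul]
      rw [this, norm_smul, norm_inv, Complex.norm_real, Real.norm_of_nonneg ht.le]
      rw [div_eq_inv_mul]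
    rw [h2] at h1
    have h3 : t ^ d = t ^ (d - s) * t ^ s := by
      rw [← pow_add, Nat.sub_add_cancel hlt.le]
    calc _ ≤ t ^ d * (M * (1 + ‖c‖ / t) ^ s) := by gcongr
      _ = _ := by
        have h4 : t + ‖c‖ = t * (1 + ‖c‖ / t) := by field_simp
        rw [h3, h4, mul_pow]; ring
  have hlim : Tendsto (fun t : ℝ => ‖r t‖) (nhdsWithin 0 (Set.Ioi 0)) (nhds ‖r 0‖) :=
    (hrc.norm.tendsto 0).mono_left nhdsWithin_le_nhds
  have hlim2 : Tendsto (fun t : ℝ => t ^ (d - s) * (M * (t + ‖c‖) ^ s))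
      (nhdsWithin 0 (Set.Ioi 0)) (nhds 0) := by
    have hcont : Continuous (fun t : ℝ => t ^ (d - s) * (M * (t + ‖c‖) ^ s)) := by fun_prop
    have := (hcont.tendsto 0).mono_left (nhdsWithin_le_nhds (s := Set.Ioi 0))
    simpa [Nat.sub_ne_zero_of_lt hlt] using this
  have := le_of_tendsto_of_tendsto hlim hlim2
    (eventually_nhdsWithin_of_forall fun t ht => hb t ht)
  rw [hr0] at this
  exact hc (norm_le_zero_iff.mp this)

end BW
namespace BW

lemma fiber {R : Type*} [CommRing R] [IsDomain R] [Algebra ℂ R] [Algebra.FiniteType ℂ R] {n : ℕ}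
    [Algebra (MvPolynomial (Fin n) ℂ) R] [IsScalarTower ℂ (MvPolynomial (Fin n) ℂ) R]
    [Algebra.IsIntegral (MvPolynomial (Fin n) ℂ) R]
    [Module.IsTorsionFree (MvPolynomial (Fin n) ℂ) R] (g : R) (x0 : Fin n → ℂ) (t0 : ℂ)
    (h : ((minpoly (MvPolynomial (Fin n) ℂ) g).map (MvPolynomial.eval x0)).eval t0 = 0) :
    ∃ φ : R →ₐ[ℂ] ℂ, (∀ b, φ (algebraMap (MvPolynomial (Fin n) ℂ) R b) = MvPolynomial.eval x0 b) ∧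
      φ g = t0 := by
  let _ : Algebra (Polynomial (MvPolynomial (Fin n) ℂ)) R := (Polynomial.aeval (R := (MvPolynomial (Fin n) ℂ)) g).toRingHom.toAlgebra
  have hmap : ∀ f : Polynomial (MvPolynomial (Fin n) ℂ), algebraMap (Polynomial (MvPolynomial (Fin n) ℂ)) R f = Polynomial.aeval g f :=
    fun f => rfl
  have : IsScalarTower (MvPolynomial (Fin n) ℂ) (Polynomial (MvPolynomial (Fin n) ℂ)) R := IsScalarTower.of_algebraMap_eq (fun b => by
    rw [hmap]; simp)
  have : Algebra.IsIntegral (Polynomial (MvPolynomial (Fin n) ℂ)) R := Algebra.IsIntegral.tower_top (R := (MvPolynomial (Fin n) ℂ))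
  let e : Polynomial (MvPolynomial (Fin n) ℂ) →+* ℂ := Polynomial.eval₂RingHom (MvPolynomial.eval x0) t0
  have he : Function.Surjective e := fun a => ⟨Polynomial.C (MvPolynomial.C a), by simp [e]⟩
  have hmax : (RingHom.ker e).IsMaximal := RingHom.ker_isMaximal_of_surjective e he
  have hg : IsIntegral (MvPolynomial (Fin n) ℂ) g := Algebra.IsIntegral.isIntegral g
  obtain ⟨Q, -, hQ, hQm⟩ := Ideal.exists_ideal_over_prime_of_isIntegral (S := R) (RingHom.ker e)
    (⊥ : Ideal R) (by
      intro f hf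
      rw [Ideal.mem_comap, Ideal.mem_bot, hmap] at hf
      obtain ⟨q, rfl⟩ := minpoly.isIntegrallyClosed_dvd hg hf
      rw [RingHom.mem_ker, map_mul]
      rw [Polynomial.eval_map] at h
      simp [e, h])
  have hQmax : Q.IsMaximal :=
    Ideal.isMaximal_of_isIntegral_of_isMaximal_comap (R := Polynomial (MvPolynomial (Fin n) ℂ)) Q (hQm ▸ hmax)
  let _ : Field (R ⧸ Q) := Ideal.Quotient.field Q
  have : Module.Finite ℂ (R ⧸ Q) := finite_of_finite_type_of_isJacobsonRing ℂ (R ⧸ Q)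
  have hbij : Function.Bijective (algebraMap ℂ (R ⧸ Q)) :=
    IsAlgClosed.algebraMap_bijective_of_isIntegral
  let E : ℂ ≃ₐ[ℂ] (R ⧸ Q) := AlgEquiv.ofBijective (Algebra.ofId ℂ (R ⧸ Q)) hbij
  let φ : R →ₐ[ℂ] ℂ := (E.symm : (R ⧸ Q) →ₐ[ℂ] ℂ).comp (Ideal.Quotient.mkₐ ℂ Q)
  have hφ : ∀ r ∈ Q, φ r = 0 := by
    intro r hr
    have : Ideal.Quotient.mkₐ ℂ Q r = 0 := by
      simpa using Ideal.Quotient.eq_zero_iff_mem.mpr hr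
    simp only [φ, AlgHom.comp_apply, this, map_zero]
  have key : ∀ f : Polynomial (MvPolynomial (Fin n) ℂ), φ (Polynomial.aeval g f) = e f := by
    intro f
    have h1 : f - Polynomial.C (MvPolynomial.C (e f)) ∈ RingHom.ker e := by
      rw [RingHom.mem_ker, map_sub]; simp [e]
    rw [← hQm, Ideal.mem_comap, hmap] at h1
    have h2 := hφ _ h1
    rw [map_sub, map_sub, sub_eq_zero] at h2
    rw [h2, Polynomial.aeval_C]
    have : algebraMap (MvPolynomial (Fin n) ℂ) R (MvPolynomial.C (e f)) = algebraMap ℂ R (e f) :=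
      (IsScalarTower.algebraMap_apply ℂ (MvPolynomial (Fin n) ℂ) R _).symm
    rw [this, AlgHom.commutes]; rfl
  refine ⟨φ, fun b => ?_, ?_⟩
  · simpa [e] using key (Polynomial.C b)
  · simpa [e] using key Polynomial.X

lemma deg_aeval {n N : ℕ} (a : MvPolynomial (Fin n) ℂ) (X : Fin n → MvPolynomial (Fin N) ℂ)
    (hX : ∀ i, (X i).totalDegree ≤ 1) :
    (MvPolynomial.aeval X a).totalDegree ≤ a.totalDegree := by
  rw [MvPolynomial.aeval_def, MvPolynomial.eval₂_eq']
  refine MvPolynomial.totalDegree_finsetSum_le fun m hm => ?_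
  refine (MvPolynomial.totalDegree_mul _ _).trans ?_
  have h1 : (algebraMap ℂ (MvPolynomial (Fin N) ℂ) (a.coeff m)).totalDegree = 0 := by
    simp [MvPolynomial.algebraMap_eq]
  rw [h1, zero_add]
  refine (MvPolynomial.totalDegree_finsetProd _ _).trans ?_
  refine le_trans ?_ (degree_le a hm)
  rw [Finsupp.degree_eq_sum]
  refine Finset.sum_le_sum fun i _ => ?_
  refine (MvPolynomial.totalDegree_pow _ _).trans ?_
  simpa using Nat.mul_le_mul_left (m i) (hX i)

lemma span_lin {R : Type*} [CommRing R] [Algebra ℂ R] {N : ℕ} (z : Fin N → R) (y : R)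
    (hy : y ∈ Submodule.span ℂ (Set.range z)) :
    ∃ q : MvPolynomial (Fin N) ℂ, q.totalDegree ≤ 1 ∧ MvPolynomial.aeval z q = y := by
  have : Submodule.span ℂ (Set.range z) ≤
      (MvPolynomial.restrictTotalDegree (Fin N) ℂ 1).map (MvPolynomial.aeval z).toLinearMap := by
    rw [Submodule.span_le]
    rintro _ ⟨i, rfl⟩
    refine ⟨MvPolynomial.X i, ?_, by simp⟩
    rw [SetLike.mem_coe, MvPolynomial.mem_restrictTotalDegree]
    simp
  obtain ⟨q, hq, rfl⟩ := this hy
  exact ⟨q, (MvPolynomial.mem_restrictTotalDegree _ _ _).mp hq, rfl⟩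

lemma main_alg {R : Type*} [CommRing R] [IsDomain R] [Algebra ℂ R] {N : ℕ} (z : Fin N → R)
    (hz : Function.Surjective (MvPolynomial.aeval (R := ℂ) z)) (g : R) (s : ℕ) (M : ℝ)
    (hg : ∀ φ : R →ₐ[ℂ] ℂ, ‖φ g‖ ≤ M * (1 + ‖fun i => φ (z i)‖) ^ s) :
    ∃ D : ℕ, ∀ m : ℕ, ∃ q : MvPolynomial (Fin N) ℂ, q.totalDegree ≤ m * s + D ∧
      MvPolynomial.aeval z q = g ^ m := by
  obtain ⟨n, x, hx, hai, hintegral⟩ := noether (k := ℂ) N z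
  have hft : Algebra.FiniteType ℂ R := Algebra.FiniteType.of_surjective _ hz
  let _ : Algebra (MvPolynomial (Fin n) ℂ) R := (MvPolynomial.aeval (R := ℂ) x).toRingHom.toAlgebra
  have hmap : ∀ b : MvPolynomial (Fin n) ℂ, algebraMap _ R b = MvPolynomial.aeval x b :=
    fun b => rfl
  have hst : IsScalarTower ℂ (MvPolynomial (Fin n) ℂ) R := IsScalarTower.of_algebraMap_eq
    (fun b => by rw [hmap]; simp [MvPolynomial.algebraMap_eq])
  have hii : Algebra.IsIntegral (MvPolynomial (Fin n) ℂ) R := by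
    refine ⟨fun y => ?_⟩
    obtain ⟨q, rfl⟩ := hz y
    induction q using MvPolynomial.induction_on with
    | C a =>
      have : MvPolynomial.aeval z (MvPolynomial.C a) =
        algebraMap (MvPolynomial (Fin n) ℂ) R (MvPolynomial.C a) := by simp [hmap]
      rw [this]; exact isIntegral_algebraMap
    | add p q hp hq => rw [map_add]; exact hp.add hq
    | mul_X p i hp =>
      rw [map_mul, MvPolynomial.aeval_X]
      exact hp.mul (int_spec x (z i) (hintegral i))
  have htf : Module.IsTorsionFree (MvPolynomial (Fin n) ℂ) R := by
    have : FaithfulSMul (MvPolynomial (Fin n) ℂ) R :=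
      (faithfulSMul_iff_algebraMap_injective _ _).mpr hai
    infer_instance
  choose L hL0 hL using fun i => lin_bound x (z i) (hintegral i)
  have hL' : ∃ L' : ℝ, 0 ≤ L' ∧ ∀ φ : R →ₐ[ℂ] ℂ,
      1 + ‖fun i => φ (z i)‖ ≤ L' * (1 + ‖fun j => φ (x j)‖) := by
    have hs : 0 ≤ ∑ i, L i := Finset.sum_nonneg fun i _ => hL0 i
    refine ⟨1 + ∑ i, L i, by positivity, fun φ => ?_⟩
    have h1 : ‖fun i => φ (z i)‖ ≤ (∑ i, L i) * (1 + ‖fun j => φ (x j)‖) := by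
      rw [pi_norm_le_iff_of_nonneg (by positivity)]
      intro i
      refine (hL i φ).trans ?_
      gcongr
      exact Finset.single_le_sum (fun i _ => hL0 i) (Finset.mem_univ i)
    nlinarith [norm_nonneg (fun j => φ (x j))]
  obtain ⟨L', hL'0, hL'⟩ := hL'
  set μ := minpoly (MvPolynomial (Fin n) ℂ) g with hμ
  have hgi : IsIntegral (MvPolynomial (Fin n) ℂ) g := Algebra.IsIntegral.isIntegral g
  have hmon : μ.Monic := minpoly.monic hgi
  set d := μ.natDegree with hd
  -- degree bounds for the coefficients
  have hdeg : ∀ i, (μ.coeff i).totalDegree ≤ (d - i) * s := by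
    intro i
    refine deg_le_of_growth _ ((|M| * L' ^ s) ^ (d - i) * (d.choose i)) _ fun x0 => ?_
    have h1 := Polynomial.coeff_le_of_roots_le (p := μ) (f := MvPolynomial.eval x0)
      (B := |M| * L' ^ s * (1 + ‖x0‖) ^ s) i hmon (IsAlgClosed.splits _) (by
        intro t ht
        have ht' := (Polynomial.mem_roots'.mp ht).2
        obtain ⟨φ, hφ, hφg⟩ := fiber g x0 t ht'
        have hφx : (fun j => φ (x j)) = x0 := by
          ext j
          have := hφ (MvPolynomial.X j)
          rw [hmap] at this
          simpa using this
        rw [← hφg]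
        calc ‖φ g‖ ≤ M * (1 + ‖fun i => φ (z i)‖) ^ s := hg φ
          _ ≤ |M| * (1 + ‖fun i => φ (z i)‖) ^ s := by gcongr; exact le_abs_self M
          _ ≤ |M| * (L' * (1 + ‖fun j => φ (x j)‖)) ^ s := by gcongr; exact hL' φ
          _ = _ := by rw [hφx, mul_pow]; ring)
    rw [Polynomial.coeff_map] at h1
    refine h1.trans (le_of_eq ?_)
    rw [mul_pow, ← pow_mul, mul_comm s]
    ring
  choose Xp hXp hXpx using fun j => span_lin z (x j) (hx j)
  have hcoef : ∀ i, ∃ a : MvPolynomial (Fin N) ℂ, a.totalDegree ≤ (d - i) * s ∧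
      MvPolynomial.aeval z a = algebraMap _ R (μ.coeff i) := by
    intro i
    refine ⟨MvPolynomial.aeval Xp (μ.coeff i), (deg_aeval _ Xp hXp).trans (hdeg i), ?_⟩
    rw [hmap, ← AlgHom.comp_apply]
    congr 1
    ext j
    simp [hXpx]
  choose a ha haz using hcoef
  obtain ⟨g', hg'⟩ := hz g
  have hrel : g ^ d = - ∑ i ∈ Finset.range d, MvPolynomial.aeval z (a i) * g ^ i := by
    have h0 : Polynomial.aeval g μ = 0 := minpoly.aeval _ _
    rw [Polynomial.aeval_eq_sum_range, Finset.sum_range_succ, hmon.coeff_natDegree, one_smul] at h0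
    simp_rw [Algebra.smul_def, ← haz] at h0
    linear_combination h0
  refine ⟨d * g'.totalDegree, fun m => ?_⟩
  induction m using Nat.strong_induction_on with
  | _ m ih =>
    by_cases hm : m < d
    · refine ⟨g' ^ m, ?_, by rw [map_pow, hg']⟩
      refine (MvPolynomial.totalDegree_pow _ _).trans ?_
      have := Nat.mul_le_mul_right g'.totalDegree hm.le
      omega
    · push Not at hm
      have : ∀ i, ∃ q : MvPolynomial (Fin N) ℂ, i < d →
          (q.totalDegree ≤ (m - d + i) * s + d * g'.totalDegree ∧
          MvPolynomial.aeval z q = g ^ (m - d + i)) := by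
        intro i
        by_cases hi : i < d
        · obtain ⟨q, hq⟩ := ih (m - d + i) (by omega)
          exact ⟨q, fun _ => hq⟩
        · exact ⟨0, fun h => absurd h hi⟩
      choose q hq using this
      refine ⟨- ∑ i ∈ Finset.range d, a i * q i, ?_, ?_⟩
      · rw [MvPolynomial.totalDegree_neg]
        refine MvPolynomial.totalDegree_finsetSum_le fun i hi => ?_
        have hi' := Finset.mem_range.mp hi
        refine (MvPolynomial.totalDegree_mul _ _).trans ?_
        refine (add_le_add (ha i) (hq i hi').1).trans ?_
        rw [← add_assoc, ← add_mul]
        have : d - i + (m - d + i) = m := by omega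
        rw [this]
      · have : g ^ m = g ^ (m - d) * g ^ d := by rw [← pow_add, Nat.sub_add_cancel hm]
        rw [this, hrel, map_neg, map_sum, mul_neg, Finset.mul_sum]
        congr 1
        refine Finset.sum_congr rfl fun i hi => ?_
        rw [map_mul, (hq i (Finset.mem_range.mp hi)).2, pow_add]
        ring

end BW
namespace BW

lemma growth {N : ℕ} (A : Set (EuclideanSpace ℂ (Fin N))) (p : MvPolynomial (Fin N) ℂ)
    (s t : ℕ) (ht : 0 < t)
    (h : growthExp (fun y => evalAt y p) A < (((s : ℝ) / t : ℝ) : EReal)) :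
    ∃ M : ℝ, 0 ≤ M ∧ ∀ z ∈ A, ‖evalAt z p‖ ^ t ≤ M * (1 + ‖z‖) ^ s := by
  have h1 := Filter.eventually_lt_of_limsup_lt h
  rw [atInftyOn, Filter.eventually_inf_principal, Filter.eventually_comap,
    Filter.eventually_atTop] at h1
  obtain ⟨r, hr⟩ := h1
  have hcont : Continuous (fun z : EuclideanSpace ℂ (Fin N) => evalAt z p) := by
    have h1 : Continuous (fun z : EuclideanSpace ℂ (Fin N) => (fun i => z i)) := by fun_prop
    exact (MvPolynomial.continuous_eval p).comp h1
  obtain ⟨M, hM⟩ := (isCompact_closedBall (0 : EuclideanSpace ℂ (Fin N))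
    (max r 2)).exists_bound_of_continuousOn hcont.continuousOn
  refine ⟨1 + |M| ^ t, by positivity, fun z hz => ?_⟩
  have hz1 : 1 ≤ (1 + ‖z‖) ^ s := one_le_pow₀ (by linarith [norm_nonneg z])
  rcases le_total ‖z‖ (max r 2) with hzr | hzr
  · have h2 := hM z (by simpa using hzr)
    have h3 : ‖evalAt z p‖ ^ t ≤ |M| ^ t :=
      pow_le_pow_left₀ (norm_nonneg _) (h2.trans (le_abs_self M)) t
    have h4 : 0 ≤ |M| ^ t := by positivity
    nlinarith
  · have h2 := hr ‖z‖ ((le_max_left _ _).trans hzr) z rfl hz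
    have hz2 : 2 ≤ ‖z‖ := (le_max_right _ _).trans hzr
    have hlog : 0 < Real.log ‖z‖ := Real.log_pos (by linarith)
    have h3 : ‖evalAt z p‖ ^ t ≤ ‖z‖ ^ s := by
      by_cases hp : ‖evalAt z p‖ = 0
      · rw [hp, zero_pow ht.ne']; positivity
      · have hp' : 0 < ‖evalAt z p‖ := lt_of_le_of_ne (norm_nonneg _) (Ne.symm hp)
        rw [logRatio, elog, elog, if_neg hp, if_neg (by linarith : ‖z‖ ≠ 0), ← EReal.coe_div,
          EReal.coe_lt_coe_iff, div_lt_div_iff₀ hlog (by exact_mod_cast ht)] at h2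
        rw [← Real.log_le_log_iff (by positivity) (by positivity), Real.log_pow, Real.log_pow]
        linarith
    have h4 : ‖z‖ ^ s ≤ (1 + ‖z‖) ^ s := by gcongr; linarith
    have h5 : 0 ≤ |M| ^ t := by positivity
    nlinarith

lemma mem_vanish {N : ℕ} (A : Set (EuclideanSpace ℂ (Fin N))) (q : MvPolynomial (Fin N) ℂ) :
    q ∈ vanishIdeal A ↔ ∀ z ∈ A, evalAt z q = 0 := by
  rw [vanishIdeal, RingHom.mem_ker, funext_iff]
  exact ⟨fun h z hz => h ⟨z, hz⟩, fun h z => h z.1 z.2⟩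

lemma rep {N : ℕ} (A : Set (EuclideanSpace ℂ (Fin N)))
    (halg : IsAlgebraicSet A) (hprime : (vanishIdeal A).IsPrime)
    (p : MvPolynomial (Fin N) ℂ) (s t : ℕ) (ht : 0 < t)
    (h : growthExp (fun y => evalAt y p) A < (((s : ℝ) / t : ℝ) : EReal)) :
    ∃ D : ℕ, ∀ m : ℕ, ∃ q : MvPolynomial (Fin N) ℂ, q.totalDegree ≤ m * s + D ∧
      ∀ z ∈ A, evalAt z q = evalAt z p ^ (t * m) := by
  obtain ⟨M, hM0, hM⟩ := growth A p s t ht h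
  let π := Ideal.Quotient.mkₐ ℂ (vanishIdeal A)
  let zz : Fin N → MvPolynomial (Fin N) ℂ ⧸ vanishIdeal A := fun i => π (MvPolynomial.X i)
  have hae : MvPolynomial.aeval zz = π := by
    ext i; simp [zz]
  let T := ((EuclideanSpace.equiv (Fin N) ℂ).symm : (Fin N → ℂ) →L[ℂ] EuclideanSpace ℂ (Fin N))
  obtain ⟨D, hD⟩ := main_alg zz (by rw [hae]; exact Ideal.Quotient.mkₐ_surjective _ _) (π (p ^ t)) s
    (M * (1 + ‖T‖) ^ s) (by
      intro φ
      set v : Fin N → ℂ := fun i => φ (zz i) with hv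
      have hev : ∀ q, evalAt (T v) q = φ (π q) := by
        intro q
        have h1 : φ.comp π = MvPolynomial.aeval v := by
          ext i; simp [v, zz]
        have h2 := DFunLike.congr_fun h1 q
        rw [AlgHom.comp_apply] at h2
        rw [h2, MvPolynomial.aeval_eq_eval]
        rfl
      have hA : T v ∈ A := by
        obtain ⟨S, hS⟩ := halg
        have : T v ∈ {z | ∀ p ∈ S, evalAt z p = 0} := by
          intro q hq
          have : q ∈ vanishIdeal A := by
            rw [mem_vanish]
            intro z hz
            rw [hS] at hz
            exact hz q hq
          rw [hev]
          have h0 : π q = 0 := by simpa [π] using Ideal.Quotient.eq_zero_iff_mem.mpr this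
          rw [h0, map_zero]
        rw [hS]; exact this
      have h1 := hM _ hA
      rw [hev] at h1
      rw [map_pow, map_pow, norm_pow]
      refine h1.trans ?_
      rw [mul_assoc, ← mul_pow]
      gcongr
      have h2 := T.le_opNorm v
      nlinarith [norm_nonneg T, norm_nonneg v])
  refine ⟨D, fun m => ?_⟩
  obtain ⟨q, hq, hqe⟩ := hD m
  refine ⟨q, hq, fun z hz => ?_⟩
  rw [hae, ← map_pow, ← pow_mul] at hqe
  have h1 : q - p ^ (t * m) ∈ vanishIdeal A := Ideal.Quotient.eq.mp hqe
  have h2 := (mem_vanish A _).mp h1 z hz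
  simp only [evalAt, map_sub, map_pow] at h2 ⊢
  exact sub_eq_zero.mp h2

lemma green_nonneg {N : ℕ} [NeZero N] (K : Set (EuclideanSpace ℂ (Fin N))) (hK : IsCompact K)
    (z : EuclideanSpace ℂ (Fin N)) : 0 ≤ greenV K z := by
  obtain ⟨M, hM⟩ := hK.isBounded.exists_norm_le
  have hM' : 0 < |M| + 1 := by positivity
  let a : ℂ := (((|M| + 1)⁻¹ : ℝ) : ℂ)
  have ha : ‖a‖ = (|M| + 1)⁻¹ := by
    simp only [a]
    rw [Complex.norm_real, Real.norm_of_nonneg (by positivity)]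
  have ha0 : a ≠ 0 := by
    rw [← norm_pos_iff, ha]; positivity
  let q : MvPolynomial (Fin N) ℂ := MvPolynomial.C a * MvPolynomial.X 0
  have hq : q.totalDegree = 1 := by
    have : (MvPolynomial.C a : MvPolynomial (Fin N) ℂ) ≠ 0 := by simpa using ha0
    simp only [q]
    rw [MvPolynomial.totalDegree_mul_of_isDomain this (MvPolynomial.X_ne_zero _)]
    simp
  refine le_trans ?_ (le_sSup ⟨q, hq.ge, ?_, rfl⟩)
  · exact_mod_cast mul_nonneg (by positivity) (le_max_right _ _)
  · intro w hw
    simp only [evalAt, q, map_mul, MvPolynomial.eval_C, MvPolynomial.eval_X, norm_mul]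
    rw [ha, inv_mul_le_one₀ hM']
    have h1 := PiLp.norm_apply_le w 0
    linarith [hM w hw, le_abs_self M]

end BW
/-- **Bernstein–Walsh inequality on algebraic sets.** Let `𝒜 ⊆ ℂᴺ` be an
irreducible algebraic set of positive dimension (equiv., infinite), `K ⊆ 𝒜` a nonempty
compact set, and `p` a polynomial with `sup_K |p| ≤ 1` and `0 < ρ(p,𝒜) < ∞`. Then
`log |p(z)| ≤ ρ(p,𝒜) · V_K(z)` for every `z ∈ 𝒜`. -/
theorem statement11 {N : ℕ} (A : Set (EuclideanSpace ℂ (Fin N)))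
    (halg : IsAlgebraicSet A) (hprime : (vanishIdeal A).IsPrime) (hinf : A.Infinite)
    (K : Set (EuclideanSpace ℂ (Fin N))) (hKA : K ⊆ A) (hKne : K.Nonempty)
    (hK : IsCompact K)
    (p : MvPolynomial (Fin N) ℂ) (hpK : ∀ w ∈ K, ‖evalAt w p‖ ≤ 1)
    (hρ0 : 0 < growthExp (fun y => evalAt y p) A)
    (hρt : growthExp (fun y => evalAt y p) A < ⊤) :
    ∀ z ∈ A, elog ‖evalAt z p‖ ≤ growthExp (fun y => evalAt y p) A * greenV K z := by
  intro z hz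
  have hN : NeZero N := by
    refine ⟨?_⟩
    rintro rfl
    exact hinf (Set.toFinite A)
  have hV0 : 0 ≤ greenV K z := BW.green_nonneg K hK z
  have hR : 0 ≤ growthExp (fun y => evalAt y p) A * greenV K z := mul_nonneg hρ0.le hV0
  by_cases hp : ‖evalAt z p‖ = 0
  · rw [elog, if_pos hp]; exact bot_le
  rw [elog, if_neg hp]
  by_cases hVt : greenV K z = ⊤
  · rw [hVt, EReal.mul_top_of_pos hρ0]; exact le_top
  set ρ := growthExp (fun y => evalAt y p) A with hρ
  obtain ⟨v, hv⟩ : ∃ v : ℝ, (v : EReal) = greenV K z :=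
    ⟨_, EReal.coe_toReal hVt (fun h => by rw [h] at hV0; simp at hV0)⟩
  obtain ⟨r, hr⟩ : ∃ r : ℝ, (r : EReal) = ρ :=
    ⟨_, EReal.coe_toReal hρt.ne (fun h => by rw [h] at hρ0; simp at hρ0)⟩
  have hv0 : 0 ≤ v := by rw [← hv] at hV0; exact_mod_cast hV0
  have hr0 : 0 < r := by rw [← hr] at hρ0; exact_mod_cast hρ0
  rw [← hv, ← hr, ← EReal.coe_mul, EReal.coe_le_coe_iff]
  set L := Real.log ‖evalAt z p‖ with hL
  have key : ∀ s t : ℕ, 0 < t → r < (s : ℝ) / t → L ≤ (s : ℝ) / t * v := by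
    intro s t ht hst
    obtain ⟨D, hD⟩ := BW.rep A halg hprime p s t ht (by
      rw [← hρ, ← hr]; exact_mod_cast hst)
    have hm : ∀ m : ℕ, 0 < m → (m : ℝ) * (t * L - s * v) ≤ D * v := by
      intro m hm0
      obtain ⟨q, hq, hqe⟩ := hD m
      have hqK : ∀ w ∈ K, ‖evalAt w q‖ ≤ 1 := by
        intro w hw
        rw [hqe w (hKA hw), norm_pow]
        exact pow_le_one₀ (norm_nonneg _) (hpK w hw)
      have hlog : Real.log ‖evalAt z q‖ = t * m * L := by
        rw [hqe z hz, norm_pow, Real.log_pow]; push_cast; rfl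
      have hqd : (q.totalDegree : ℝ) ≤ m * s + D := by exact_mod_cast hq
      have hle : t * m * L ≤ (m * s + D) * v := by
        by_cases h1 : 1 ≤ q.totalDegree
        · have h2 : (((q.totalDegree : ℝ)⁻¹ * max (Real.log ‖evalAt z q‖) 0 : ℝ) : EReal)
              ≤ greenV K z := le_sSup ⟨q, h1, hqK, rfl⟩
          rw [← hv, EReal.coe_le_coe_iff, hlog] at h2
          have h3 : (0 : ℝ) < q.totalDegree := by exact_mod_cast h1
          rw [inv_mul_le_iff₀ h3] at h2
          exact (le_max_left _ _).trans (h2.trans (mul_le_mul_of_nonneg_right hqd hv0))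
        · have h2 : q.totalDegree = 0 := by omega
          rw [MvPolynomial.totalDegree_eq_zero_iff_eq_C] at h2
          obtain ⟨w, hw⟩ := hKne
          have h3 : evalAt z q = evalAt w q := by
            rw [h2]; simp [evalAt]
          have h4 : Real.log ‖evalAt z q‖ ≤ 0 := by
            rw [h3]; exact Real.log_nonpos (norm_nonneg _) (hqK w hw)
          rw [hlog] at h4
          exact h4.trans (by positivity)
      linarith
    have hneg : t * L - s * v ≤ 0 := by
      by_contra! hpos
      obtain ⟨m, hm1⟩ := exists_nat_gt (D * v / (t * L - s * v))
      rw [div_lt_iff₀ hpos] at hm1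
      have h0 : 0 < m := by
        rcases Nat.eq_zero_or_pos m with h | h
        · subst h
          have : 0 ≤ (D : ℝ) * v := by positivity
          simp at hm1; linarith
        · exact h
      linarith [hm m h0]
    have ht' : (0 : ℝ) < t := by exact_mod_cast ht
    rw [div_mul_eq_mul_div, le_div_iff₀ ht']
    linarith
  have hq : ∀ e : ℝ, r < e → L ≤ e * v := by
    intro e he
    obtain ⟨c, hc1, hc2⟩ := exists_rat_btwn he
    have hc0 : (0 : ℝ) < c := hr0.trans hc1
    have hc0' : 0 < c := by exact_mod_cast hc0
    have hcn : (c : ℝ) = ((c.num.toNat : ℕ) : ℝ) / (c.den : ℝ) := by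
      have h1 : ((c.num.toNat : ℕ) : ℤ) = c.num := Int.toNat_of_nonneg (Rat.num_pos.mpr hc0').le
      have h2 : ((c.num.toNat : ℕ) : ℝ) = (c.num : ℝ) := by exact_mod_cast h1
      rw [h2]; exact Rat.cast_def c
    have := key c.num.toNat c.den c.den_pos (hcn ▸ hc1)
    rw [← hcn] at this
    exact this.trans (mul_le_mul_of_nonneg_right hc2.le hv0)
  have hlim : Tendsto (fun e : ℝ => e * v) (nhdsWithin r (Set.Ioi r)) (nhds (r * v)) :=
    ((continuous_id.mul continuous_const).tendsto r).mono_left nhdsWithin_le_nhds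
  exact ge_of_tendsto hlim (eventually_nhdsWithin_of_forall fun e he => hq e he)
end
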